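/- arXiv:2005.09307 — 3 statements merged into one kernel-verified Lean document; each statement's English description precedes it below -/
import Mathlib

section
/- For every integer k ≥ 2, ∏_{i=1}^{k} (1 + 1/p_i) ≤ (3/4) · (e^γ · log(log N_k) + 2.51/log(log N_k)). -/
open Real Finset

/-- `Nk k` is the `k`-th primorial: the product of the first `k` primes
(`Nat.nth Nat.Prime i` is the `(i+1)`-st prime, so `Nat.nth Nat.Prime 0 = 2`). -/
noncomputable def Nk (k : ℕ) : ℕ := ∏ i ∈ Finset.range k, Nat.nth Nat.Prime i

/-- `M k = exp (e^(-γ) * N_k / φ(N_k)) - log N_k`. -/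
noncomputable def M (k : ℕ) : ℝ :=
  Real.exp (Real.exp (-Real.eulerMascheroniConstant) * (Nk k : ℝ) / (Nat.totient (Nk k) : ℝ))
    - Real.log (Nk k)


/-! ### Numerics over the primes up to 8192 -/

/-- Product of the primes up to 89. -/
def primeProd89 : ℕ := 23768741896345550770650537601358310

/-- Kernel-friendly primality test, valid below `97 ^ 2`. -/
def tp (n : ℕ) : Bool :=
  ((Nat.blt 1 n) && Nat.beq (Nat.gcd n primeProd89) 1) ||
    (Nat.ble n 89 && List.elem n [2, 3, 5, 7, 11, 13, 17, 19, 23, 29, 31, 37, 41, 43, 47, 53, 59,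
      61, 67, 71, 73, 79, 83, 89])

theorem tp_small : ∀ n < 97, tp n = true ↔ n.Prime := by decide +kernel

theorem dvd_primeProd89 : ∀ n < 97, n.Prime → n ∣ primeProd89 := by decide +kernel

theorem primeProd89_dvd : ∀ p : ℕ, p.Prime → p ∣ primeProd89 → p < 97 := by
  intro p hp hd
  have h : primeProd89 = [2, 3, 5, 7, 11, 13, 17, 19, 23, 29, 31, 37, 41, 43, 47, 53, 59,
      61, 67, 71, 73, 79, 83, 89].prod := by decide +kernel
  rw [h] at hd
  obtain ⟨a, ha, hpa⟩ := (hp.prime.dvd_prod_iff).1 hd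
  have hall : ∀ a ∈ [2, 3, 5, 7, 11, 13, 17, 19, 23, 29, 31, 37, 41, 43, 47, 53, 59,
      61, 67, 71, 73, 79, 83, 89], 0 < a ∧ a < 97 := by decide
  have := Nat.le_of_dvd (hall a ha).1 hpa
  have := (hall a ha).2
  omega

theorem tp_iff (n : ℕ) (hn : n < 9409) : tp n = true ↔ n.Prime := by
  rcases lt_or_ge n 97 with h | h
  · exact tp_small n h
  have e : tp n = true ↔ Nat.gcd n primeProd89 = 1 := by
    have h1 : Nat.ble n 89 = false := by
      rw [Bool.eq_false_iff]; intro hh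
      have := Nat.le_of_ble_eq_true hh
      omega
    have h2 : Nat.blt 1 n = true := by
      simp only [Nat.blt_eq]; omega
    simp [tp, h1, h2]
  rw [e]
  constructor
  · intro hg
    by_contra hp
    have h3 := Nat.minFac_sq_le_self (by omega) hp
    have h4 : n.minFac < 97 := by nlinarith
    have h5 : n.minFac.Prime := Nat.minFac_prime (by omega)
    have h6 := Nat.dvd_gcd (Nat.minFac_dvd n) (dvd_primeProd89 _ h4 h5)
    rw [hg] at h6
    exact h5.one_lt.ne' (Nat.dvd_one.1 h6)
  · intro hp
    rcases (Nat.dvd_prime hp).1 (Nat.gcd_dvd_left n primeProd89) with h3 | h3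
    · exact h3
    · have := primeProd89_dvd n hp (h3 ▸ Nat.gcd_dvd_right n primeProd89)
      omega

/-- Sum of `g` over the primes in `[a, a + f)`. -/
def fs (g : ℕ → ℕ) (a : ℕ) : ℕ → ℕ
  | 0 => 0
  | f + 1 => fs g a f + bif tp (a + f) then g (a + f) else 0

/-- Product of `g` over the primes in `[a, a + f)`. -/
def fp (g : ℕ → ℕ) (a : ℕ) : ℕ → ℕ
  | 0 => 1
  | f + 1 => fp g a f * bif tp (a + f) then g (a + f) else 1

/-- The primes up to `n`. -/
def PS (n : ℕ) : Finset ℕ := (Finset.range (n + 1)).filter Nat.Prime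

theorem PS_succ_prime {n : ℕ} (h : (n + 1).Prime) : PS (n + 1) = insert (n + 1) (PS n) := by
  unfold PS
  rw [Finset.range_add_one, Finset.filter_insert, if_pos h]

theorem PS_succ_not_prime {n : ℕ} (h : ¬ (n + 1).Prime) : PS (n + 1) = PS n := by
  unfold PS
  rw [Finset.range_add_one, Finset.filter_insert, if_neg h]

theorem notMem_PS (n : ℕ) : n + 1 ∉ PS n := by
  simp [PS]

theorem fs_eq (g : ℕ → ℕ) (n f : ℕ) (h : n + f < 9409) :
    ∑ p ∈ PS (n + f), g p = ∑ p ∈ PS n, g p + fs g (n + 1) f := by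
  induction f with
  | zero => simp [fs]
  | succ f ih =>
    have ih := ih (by omega)
    have e : n + 1 + f = n + f + 1 := by ring
    have ht := tp_iff (n + f + 1) (by omega)
    rw [fs, ← add_assoc, e, ← add_assoc]
    by_cases hp : (n + f + 1).Prime
    · rw [PS_succ_prime hp, Finset.sum_insert (notMem_PS _), ih, ht.2 hp]
      simp only [cond_true]
      ring
    · rw [PS_succ_not_prime hp, ih]
      have : tp (n + f + 1) = false := by
        rw [Bool.eq_false_iff]; exact fun hh => hp (ht.1 hh)
      rw [this]; simp

theorem fp_eq (g : ℕ → ℕ) (n f : ℕ) (h : n + f < 9409) :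
    ∏ p ∈ PS (n + f), g p = (∏ p ∈ PS n, g p) * fp g (n + 1) f := by
  induction f with
  | zero => simp [fp]
  | succ f ih =>
    have ih := ih (by omega)
    have e : n + 1 + f = n + f + 1 := by ring
    have ht := tp_iff (n + f + 1) (by omega)
    rw [fp, ← add_assoc, e, ← mul_assoc]
    by_cases hp : (n + f + 1).Prime
    · rw [PS_succ_prime hp, Finset.prod_insert (notMem_PS _), ih, ht.2 hp]
      simp only [cond_true]
      ring
    · rw [PS_succ_not_prime hp, ih]
      have : tp (n + f + 1) = false := by
        rw [Bool.eq_false_iff]; exact fun hh => hp (ht.1 hh)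
      rw [this]; simp

/-- Certified data at `n`. -/
def St (n U T W : ℕ) : Prop :=
  (∏ p ∈ PS n, (p + 1)) * 10 ^ 9 ≤ U * ∏ p ∈ PS n, p ∧
  T ≤ ∑ p ∈ PS n, Nat.log2 (p ^ 16) ∧
  W ≤ ∑ p ∈ PS n, 10 ^ 6 * Nat.log2 (p ^ 16) / p

theorem st_0 : St 0 1000000000 0 0 := by
  refine ⟨?_, Nat.zero_le _, Nat.zero_le _⟩
  have : PS 0 = ∅ := by decide
  simp [this]

theorem st_step {n U T W U' T' W' : ℕ} (h : St n U T W) (f : ℕ) (hf : n + f < 9409)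
    (hU : Nat.ble (U * fp (fun p => p + 1) (n + 1) f) (U' * fp (fun p => p) (n + 1) f) = true)
    (hT : Nat.ble T' (T + fs (fun p => Nat.log2 (p ^ 16)) (n + 1) f) = true)
    (hW : Nat.ble W' (W + fs (fun p => 10 ^ 6 * Nat.log2 (p ^ 16) / p) (n + 1) f) = true) :
    St (n + f) U' T' W' := by
  obtain ⟨h1, h2, h3⟩ := h
  replace hU := Nat.le_of_ble_eq_true hU
  replace hT := Nat.le_of_ble_eq_true hT
  replace hW := Nat.le_of_ble_eq_true hW
  refine ⟨?_, ?_, ?_⟩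
  · rw [fp_eq _ n f hf, fp_eq (fun p => p) n f hf]
    calc _ = ((∏ p ∈ PS n, (p + 1)) * 10 ^ 9) * fp (fun p => p + 1) (n + 1) f := by ring
      _ ≤ (U * ∏ p ∈ PS n, p) * fp (fun p => p + 1) (n + 1) f := Nat.mul_le_mul_right _ h1
      _ = (∏ p ∈ PS n, p) * (U * fp (fun p => p + 1) (n + 1) f) := by ring
      _ ≤ (∏ p ∈ PS n, p) * (U' * fp (fun p => p) (n + 1) f) := Nat.mul_le_mul_left _ hU
      _ = _ := by ring
  · rw [fs_eq _ n f hf]; omega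
  · rw [fs_eq _ n f hf]; omega

theorem st_12 : St 12 2992207794 177 35019047 := by
  exact st_step st_0 12 (by norm_num) (by decide +kernel) (by decide +kernel) (by decide +kernel)

theorem st_22 : St 22 3591504492 368 46907352 := by
  exact st_step st_12 10 (by norm_num) (by decide +kernel) (by decide +kernel) (by decide +kernel)

theorem st_46 : St 46 4308269771 850 61557758 := by
  exact st_step st_22 24 (by norm_num) (by decide +kernel) (by decide +kernel) (by decide +kernel)

theorem st_112 : St 112 5257682809 2348 81269457 := by
  exact st_step st_46 66 (by norm_num) (by decide +kernel) (by decide +kernel) (by decide +kernel)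

theorem st_388 : St 388 6500574212 8244 107373265 := by
  exact st_step st_112 276 (by norm_num) (by decide +kernel) (by decide +kernel) (by decide +kernel)

theorem st_988 : St 988 7494359594 21671 128377345 := by
  exact st_step st_388 600 (by norm_num) (by decide +kernel) (by decide +kernel) (by decide +kernel)

theorem st_1588 : St 1588 8010668905 35487 139309352 := by
  exact st_step st_988 600 (by norm_num) (by decide +kernel) (by decide +kernel) (by decide +kernel)

theorem st_1692 : St 1692 8074817622 37701 140668088 := by
  exact st_step st_1588 104 (by norm_num) (by decide +kernel) (by decide +kernel) (by decide +kernel)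

theorem st_2292 : St 2292 8396162850 51155 147481158 := by
  exact st_step st_1692 600 (by norm_num) (by decide +kernel) (by decide +kernel) (by decide +kernel)

theorem st_2892 : St 2892 8653877373 65267 152948795 := by
  exact st_step st_2292 600 (by norm_num) (by decide +kernel) (by decide +kernel) (by decide +kernel)

theorem st_3492 : St 3492 8846036190 78276 157029331 := by
  exact st_step st_2892 600 (by norm_num) (by decide +kernel) (by decide +kernel) (by decide +kernel)

theorem st_4092 : St 4092 9023516333 92497 160795432 := by
  exact st_step st_3492 600 (by norm_num) (by decide +kernel) (by decide +kernel) (by decide +kernel)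

theorem st_4692 : St 4692 9170703305 106205 163919028 := by
  exact st_step st_4092 600 (by norm_num) (by decide +kernel) (by decide +kernel) (by decide +kernel)

theorem st_5292 : St 5292 9294715028 119342 166552612 := by
  exact st_step st_4692 600 (by norm_num) (by decide +kernel) (by decide +kernel) (by decide +kernel)

theorem st_5892 : St 5892 9418387447 134049 169179465 := by
  exact st_step st_5292 600 (by norm_num) (by decide +kernel) (by decide +kernel) (by decide +kernel)

theorem st_6492 : St 6492 9520655031 147523 171351303 := by
  exact st_step st_5892 600 (by norm_num) (by decide +kernel) (by decide +kernel) (by decide +kernel)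

theorem st_7092 : St 7092 9614955958 161137 173353979 := by
  exact st_step st_6492 600 (by norm_num) (by decide +kernel) (by decide +kernel) (by decide +kernel)

theorem st_7692 : St 7692 9702296576 174887 175209737 := by
  exact st_step st_7092 600 (by norm_num) (by decide +kernel) (by decide +kernel) (by decide +kernel)

theorem st_8192 : St 8192 9766021357 185636 176562997 := by
  exact st_step st_7692 500 (by norm_num) (by decide +kernel) (by decide +kernel) (by decide +kernel)

/-! ### Real-valued consequences -/

theorem PS_prime {n p : ℕ} (h : p ∈ PS n) : p.Prime := (Finset.mem_filter.1 h).2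

theorem PS_mono {m n : ℕ} (h : m ≤ n) : PS m ⊆ PS n := by
  intro p hp
  simp only [PS, Finset.mem_filter, Finset.mem_range] at hp ⊢
  exact ⟨by omega, hp.2⟩

theorem theta_PS (n : ℕ) : Chebyshev.theta (n : ℝ) = ∑ p ∈ PS n, Real.log p :=
  Chebyshev.theta_eq_sum_primesLE_log n

theorem log2_lower (p : ℕ) (hp : 0 < p) :
    (Nat.log2 (p ^ 16) : ℝ) * (Real.log 2 / 16) ≤ Real.log p := by
  have h1 : 2 ^ Nat.log2 (p ^ 16) ≤ p ^ 16 := Nat.log2_self_le (by positivity)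
  have h2 : Real.log ((2 : ℝ) ^ Nat.log2 (p ^ 16)) ≤ Real.log ((p : ℝ) ^ 16) :=
    Real.log_le_log (by positivity) (by exact_mod_cast h1)
  rw [Real.log_pow, Real.log_pow] at h2
  push_cast at h2
  linarith

theorem st_prod {n U T W : ℕ} (h : St n U T W) :
    ∏ p ∈ PS n, (1 + 1 / (p : ℝ)) ≤ U / 10 ^ 9 := by
  have h1 : (∏ p ∈ PS n, ((p : ℝ) + 1)) * 10 ^ 9 ≤ U * ∏ p ∈ PS n, (p : ℝ) := by
    have h0 : (((∏ p ∈ PS n, (p + 1)) * 10 ^ 9 : ℕ) : ℝ) ≤ ((U * ∏ p ∈ PS n, p : ℕ) : ℝ) :=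
      Nat.cast_le.2 h.1
    push_cast at h0
    norm_num at h0 ⊢
    exact h0
  have hpos : 0 < ∏ p ∈ PS n, (p : ℝ) :=
    Finset.prod_pos fun p hp => by exact_mod_cast (PS_prime hp).pos
  have e : ∏ p ∈ PS n, (1 + 1 / (p : ℝ)) =
      (∏ p ∈ PS n, ((p : ℝ) + 1)) / ∏ p ∈ PS n, (p : ℝ) := by
    rw [← Finset.prod_div_distrib]
    refine Finset.prod_congr rfl fun p hp => ?_
    have : (p : ℝ) ≠ 0 := by exact_mod_cast (PS_prime hp).ne_zero
    field_simp
  rw [e, div_le_div_iff₀ hpos (by positivity)]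
  exact h1

theorem st_theta {n U T W : ℕ} (h : St n U T W) :
    (T : ℝ) * (Real.log 2 / 16) ≤ Chebyshev.theta (n : ℝ) := by
  rw [theta_PS]
  have h1 : (T : ℝ) ≤ ∑ p ∈ PS n, (Nat.log2 (p ^ 16) : ℝ) := by exact_mod_cast h.2.1
  have hl : 0 ≤ Real.log 2 / 16 := by positivity
  calc _ ≤ (∑ p ∈ PS n, (Nat.log2 (p ^ 16) : ℝ)) * (Real.log 2 / 16) :=
        mul_le_mul_of_nonneg_right h1 hl
    _ = ∑ p ∈ PS n, (Nat.log2 (p ^ 16) : ℝ) * (Real.log 2 / 16) := Finset.sum_mul _ _ _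
    _ ≤ _ := Finset.sum_le_sum fun p hp => log2_lower p (PS_prime hp).pos

/-- `∑_{p ≤ n} log p / p`. -/
noncomputable def mA (n : ℕ) : ℝ := ∑ p ∈ PS n, Real.log p / p

theorem st_A {n U T W : ℕ} (h : St n U T W) :
    (W : ℝ) / 10 ^ 6 * (Real.log 2 / 16) ≤ mA n := by
  have h1 : (W : ℝ) ≤ ∑ p ∈ PS n, ((10 ^ 6 * Nat.log2 (p ^ 16) / p : ℕ) : ℝ) := by
    exact_mod_cast h.2.2
  have hl : 0 ≤ Real.log 2 / 16 := by positivity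
  calc _ ≤ (∑ p ∈ PS n, ((10 ^ 6 * Nat.log2 (p ^ 16) / p : ℕ) : ℝ)) / 10 ^ 6 * (Real.log 2 / 16) := by
        gcongr
    _ = ∑ p ∈ PS n, ((10 ^ 6 * Nat.log2 (p ^ 16) / p : ℕ) : ℝ) / 10 ^ 6 * (Real.log 2 / 16) := by
        rw [Finset.sum_div, Finset.sum_mul]
    _ ≤ _ := by
        refine Finset.sum_le_sum fun p hp => ?_
        have hp0 : (0 : ℝ) < p := by exact_mod_cast (PS_prime hp).pos
        have h2 := log2_lower p (PS_prime hp).pos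
        have h3 : ((10 ^ 6 * Nat.log2 (p ^ 16) / p : ℕ) : ℝ) ≤
            (10 ^ 6 * Nat.log2 (p ^ 16) : ℕ) / (p : ℝ) := Nat.cast_div_le
        rw [Nat.cast_mul, Nat.cast_pow, Nat.cast_ofNat] at h3
        calc _ ≤ (10 ^ 6 * (Nat.log2 (p ^ 16) : ℝ) / p) / 10 ^ 6 * (Real.log 2 / 16) := by
              gcongr
          _ = ((Nat.log2 (p ^ 16) : ℝ) * (Real.log 2 / 16)) / p := by ring
          _ ≤ _ := by gcongr

theorem exp_gamma_lower : (1.766 : ℝ) ≤ Real.exp Real.eulerMascheroniConstant := by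
  have h1 : (0.569 : ℝ) ≤ Real.eulerMascheroniConstant := by
    refine le_trans ?_ (Real.eulerMascheroniSeq_lt_eulerMascheroniConstant 63).le
    have e : Real.log ((63 : ℕ) + 1) = 6 * Real.log 2 := by
      rw [show (((63 : ℕ) : ℝ) + 1) = 2 ^ 6 by norm_num, Real.log_pow]; norm_num
    have hh : (4.728 : ℚ) ≤ harmonic 63 := by
      simp only [harmonic, Finset.sum_range_succ, Finset.sum_range_zero]
      norm_num
    have hh' : (4.728 : ℝ) ≤ (harmonic 63 : ℝ) := by
      have : ((4.728 : ℚ) : ℝ) ≤ (harmonic 63 : ℝ) := by exact_mod_cast hh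
      refine le_trans (by norm_num) this
    rw [Real.eulerMascheroniSeq, e]
    have := Real.log_two_lt_d9
    linarith
  refine le_trans ?_ (Real.exp_le_exp.2 h1)
  refine le_trans ?_ (Real.sum_le_exp_of_nonneg (by norm_num) 6)
  norm_num [Finset.sum_range_succ, Nat.factorial]

theorem F_mono {s u q : ℝ} (hs : 1.2 ≤ s) (hu : s ≤ u)
    (hq : q ≤ (3 / 4) * (1.766 * s + 2.51 / s)) :
    q ≤ (3 / 4) * (Real.exp Real.eulerMascheroniConstant * u + 2.51 / u) := by
  have hs0 : 0 < s := by linarith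
  have hu0 : 0 < u := by linarith
  have h1 : 1.766 * u ≤ Real.exp Real.eulerMascheroniConstant * u :=
    mul_le_mul_of_nonneg_right exp_gamma_lower hu0.le
  have h2 : 2.51 / s - 2.51 / u ≤ 1.766 * (u - s) := by
    have : 2.51 / s - 2.51 / u = 2.51 / (s * u) * (u - s) := by field_simp
    rw [this]
    refine mul_le_mul_of_nonneg_right ?_ (by linarith)
    rw [div_le_iff₀ (by positivity)]
    nlinarith
  linarith

/-- The target inequality in terms of `n`. -/
def Goal (n : ℕ) : Prop :=
  ∏ p ∈ PS n, (1 + 1 / (p : ℝ)) ≤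
    (3 / 4) * (Real.exp Real.eulerMascheroniConstant * Real.log (Chebyshev.theta (n : ℝ)) +
        2.51 / Real.log (Chebyshev.theta (n : ℝ)))

theorem prod_mono {m n : ℕ} (h : m ≤ n) :
    ∏ p ∈ PS m, (1 + 1 / (p : ℝ)) ≤ ∏ p ∈ PS n, (1 + 1 / (p : ℝ)) := by
  refine Finset.prod_le_prod_of_subset_of_one_le (PS_mono h) (fun p _ => by positivity) ?_
  intro p _ _
  have : (0 : ℝ) ≤ 1 / (p : ℝ) := by positivity
  linarith

theorem blk {a b n U T W U' T' W' : ℕ} (ha : St a U T W) (hb : St b U' T' W')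
    (h1 : a ≤ n) (h2 : n ≤ b) (s : ℕ) (hs0 : 120 ≤ s)
    (hs : (2.7182818286 : ℝ) ^ s ≤ (T * 0.6931 / 16) ^ 100)
    (hF : (U' : ℝ) / 10 ^ 9 ≤ (3 / 4) * (1.766 * (s / 100 : ℝ) + 2.51 / (s / 100 : ℝ))) :
    Goal n := by
  have hP := (prod_mono h2).trans (st_prod hb)
  have hs1 : (1.2 : ℝ) ≤ (s : ℝ) / 100 := by
    have : (120 : ℝ) ≤ s := by exact_mod_cast hs0
    linarith
  refine F_mono hs1 ?_ (hP.trans hF)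
  have ht : (T : ℝ) * 0.6931 / 16 ≤ Chebyshev.theta (n : ℝ) := by
    have h3 := st_theta ha
    have h4 : Chebyshev.theta (a : ℝ) ≤ Chebyshev.theta (n : ℝ) :=
      Chebyshev.theta_mono (by exact_mod_cast h1)
    have h5 := Real.log_two_gt_d9
    have h6 : (T : ℝ) * 0.6931 / 16 ≤ T * (Real.log 2 / 16) := by
      have : (0 : ℝ) ≤ T := by positivity
      nlinarith
    linarith
  have hT0 : (0 : ℝ) ≤ (T : ℝ) * 0.6931 / 16 := by positivity
  have h7 : Real.exp ((s : ℝ) / 100) ≤ T * 0.6931 / 16 := by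
    refine le_of_pow_le_pow_left₀ (n := 100) (by norm_num) hT0 ?_
    rw [← Real.exp_nat_mul]
    have : ((100 : ℕ) : ℝ) * ((s : ℝ) / 100) = s * 1 := by push_cast; ring
    rw [this, Real.exp_nat_mul]
    refine le_trans ?_ hs
    exact pow_le_pow_left₀ (Real.exp_pos _).le Real.exp_one_lt_d9.le _
  rw [Real.le_log_iff_exp_le (lt_of_lt_of_le (Real.exp_pos _) (h7.trans ht))]
  exact h7.trans ht

theorem goal_small (n : ℕ) (h3 : 3 ≤ n) (h : n ≤ 12) : Goal n := by
  have hP := (prod_mono h).trans (st_prod st_12)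
  have ht : (1.7 : ℝ) ≤ Chebyshev.theta (n : ℝ) := by
    have h4 : Chebyshev.theta (3 : ℕ) ≤ Chebyshev.theta (n : ℝ) :=
      Chebyshev.theta_mono (by exact_mod_cast h3)
    have h5 : Chebyshev.theta (3 : ℕ) = Real.log 2 + Real.log 3 := by
      rw [theta_PS, show PS 3 = {2, 3} by decide]
      rw [Finset.sum_insert (by decide), Finset.sum_singleton]
      norm_num
    have h6 := Real.log_two_gt_d9
    have h7 : 3 * Real.log 2 ≤ 2 * Real.log 3 := by
      have : Real.log ((2 : ℝ) ^ 3) ≤ Real.log ((3 : ℝ) ^ 2) :=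
        Real.log_le_log (by norm_num) (by norm_num)
      rw [Real.log_pow, Real.log_pow] at this
      exact_mod_cast this
    linarith
  have hu : 0 < Real.log (Chebyshev.theta (n : ℝ)) := Real.log_pos (by linarith)
  unfold Goal
  generalize Real.log (Chebyshev.theta (n : ℝ)) = u at hu
  refine hP.trans ?_
  have h1 : 1.766 * u ≤ Real.exp Real.eulerMascheroniConstant * u :=
    mul_le_mul_of_nonneg_right exp_gamma_lower hu.le
  have h2 : 4 ≤ 1.766 * u + 2.51 / u := by
    have : 1.766 * u + 2.51 / u = (1.766 * u ^ 2 + 2.51) / u := by field_simp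
    rw [this, le_div_iff₀ hu]
    nlinarith [sq_nonneg (u - 1.19)]
  norm_num at h1 h2 ⊢
  linarith

set_option exponentiation.threshold 2000 in
theorem goal_mid (n : ℕ) (h3 : 3 ≤ n) (h : n ≤ 8192) : Goal n := by
  rcases le_total n 12 with h1 | h1
  · exact goal_small n h3 h1
  rcases le_total n 22 with h2 | h2
  · exact blk st_12 st_22 h1 h2 203 (by norm_num) (by norm_num) (by norm_num)
  rcases le_total n 46 with h4 | h4
  · exact blk st_22 st_46 h2 h4 276 (by norm_num) (by norm_num) (by norm_num)
  rcases le_total n 112 with h5 | h5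
  · exact blk st_46 st_112 h4 h5 360 (by norm_num) (by norm_num) (by norm_num)
  rcases le_total n 388 with h6 | h6
  · exact blk st_112 st_388 h5 h6 462 (by norm_num) (by norm_num) (by norm_num)
  rcases le_total n 1692 with h7 | h7
  · exact blk st_388 st_1692 h6 h7 587 (by norm_num) (by norm_num) (by norm_num)
  · exact blk st_1692 st_8192 h7 h 739 (by norm_num) (by norm_num) (by norm_num)

/-! ### Mertens-type upper bound -/

theorem log_factorial_upper (n : ℕ) (hn : 1 ≤ n) :
    Real.log (n.factorial : ℝ) ≤ n * Real.log n - n + Real.log n + 1 := by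
  induction n, hn using Nat.le_induction with
  | base => simp
  | succ n hn ih =>
    have hn0 : (0 : ℝ) < n := by exact_mod_cast hn
    rw [Nat.factorial_succ, Nat.cast_mul, Real.log_mul (by positivity) (by positivity)]
    have h1 : 1 / ((n : ℝ) + 1) ≤ Real.log (n + 1) - Real.log n := by
      have h2 := Real.one_sub_inv_le_log_of_pos (x := ((n : ℝ) + 1) / n) (by positivity)
      rw [Real.log_div (by positivity) (by positivity)] at h2
      refine le_trans (le_of_eq ?_) h2
      field_simp
      ring
    have h3 : 1 ≤ (n + 1 : ℝ) * (Real.log (n + 1) - Real.log n) := by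
      have := mul_le_mul_of_nonneg_left h1 (by positivity : (0 : ℝ) ≤ (n : ℝ) + 1)
      rwa [mul_one_div_cancel (by positivity)] at this
    push_cast
    nlinarith

theorem log_factorial_lower (n : ℕ) :
    ∑ p ∈ PS n, (padicValNat p n.factorial : ℝ) * Real.log p ≤ Real.log (n.factorial : ℝ) := by
  rw [Real.log_nat_eq_sum_factorization, Finsupp.sum]
  have hsub : PS n ⊆ n.factorial.factorization.support := by
    intro p hp
    rw [Nat.support_factorization, Nat.mem_primeFactors]
    have hp' := PS_prime hp
    refine ⟨hp', ?_, Nat.factorial_ne_zero n⟩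
    rw [hp'.dvd_factorial]
    simp only [PS, Finset.mem_filter, Finset.mem_range] at hp
    omega
  refine le_trans (le_of_eq ?_) (Finset.sum_le_sum_of_subset_of_nonneg hsub ?_)
  · refine Finset.sum_congr rfl fun p hp => ?_
    rw [Nat.factorization_def _ (PS_prime hp)]
  · intro p _ _
    have : 0 ≤ Real.log (p : ℝ) := Real.log_natCast_nonneg p
    positivity

theorem val_lower (p n m : ℕ) (hp : p.Prime) :
    ∑ i ∈ Finset.Ico 1 (m + 1), ((n : ℝ) / (p : ℝ) ^ i - 1) ≤ padicValNat p n.factorial := by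
  have : Fact p.Prime := ⟨hp⟩
  rw [padicValNat_factorial (p := p) (n := n) (b := max (Nat.log p n + 1) (m + 1))
    (by have := le_max_left (Nat.log p n + 1) (m + 1); omega)]
  push_cast
  calc _ ≤ ∑ i ∈ Finset.Ico 1 (m + 1), ((n / p ^ i : ℕ) : ℝ) := by
        refine Finset.sum_le_sum fun i _ => ?_
        have h1 : (n : ℝ) / (p : ℝ) ^ i < ((n / p ^ i : ℕ) : ℝ) + 1 := by
          have := Nat.lt_floor_add_one ((n : ℝ) / ((p ^ i : ℕ) : ℝ))
          rw [Nat.floor_div_natCast, Nat.floor_natCast] at this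
          push_cast at this
          exact_mod_cast this
        linarith
    _ ≤ _ := by
        refine Finset.sum_le_sum_of_subset_of_nonneg ?_ (fun i _ _ => by positivity)
        exact Finset.Ico_subset_Ico le_rfl (le_max_right _ _)

/-- Number of prime powers used for each prime. -/
def mm (p : ℕ) : ℕ := if p = 2 then 8 else if p = 3 then 5 else if p = 5 then 3 else
  if p = 7 then 2 else 1

/-- Contribution of higher prime powers. -/
noncomputable def extra (n p : ℕ) : ℝ :=
  (∑ i ∈ Finset.Ico 2 (mm p + 1), ((n : ℝ) / (p : ℝ) ^ i - 1)) * Real.log p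

theorem one_le_mm (p : ℕ) : 1 ≤ mm p := by
  unfold mm; split_ifs <;> norm_num

theorem sum_extra (n : ℕ) (hn : 7 ≤ n) :
    ∑ p ∈ PS n, extra n p = extra n 2 + extra n 3 + extra n 5 + extra n 7 := by
  have hsub : ({2, 3, 5, 7} : Finset ℕ) ⊆ PS n := by
    intro p hp
    simp only [PS, Finset.mem_filter, Finset.mem_range]
    simp only [Finset.mem_insert, Finset.mem_singleton] at hp
    rcases hp with rfl | rfl | rfl | rfl <;> exact ⟨by omega, by norm_num⟩
  rw [← Finset.sum_subset hsub]
  · rw [Finset.sum_insert (by decide), Finset.sum_insert (by decide),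
      Finset.sum_insert (by decide), Finset.sum_singleton]
    ring
  · intro p _ hp
    simp only [Finset.mem_insert, Finset.mem_singleton, not_or] at hp
    simp [extra, mm, hp]

theorem mertens_raw (n : ℕ) (hn : 7 ≤ n) :
    n * mA n - Chebyshev.theta (n : ℝ) + (extra n 2 + extra n 3 + extra n 5 + extra n 7) ≤
      n * Real.log n - n + Real.log n + 1 := by
  refine le_trans ?_ (log_factorial_upper n (by omega))
  refine le_trans ?_ (log_factorial_lower n)
  rw [← sum_extra n hn, theta_PS, mA, Finset.mul_sum, ← Finset.sum_sub_distrib,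
    ← Finset.sum_add_distrib]
  refine Finset.sum_le_sum fun p hp => ?_
  have h1 := val_lower p n (mm p) (PS_prime hp)
  rw [Finset.sum_eq_sum_Ico_succ_bot (by have := one_le_mm p; omega)] at h1
  have hl : 0 ≤ Real.log (p : ℝ) := Real.log_natCast_nonneg p
  have h2 := mul_le_mul_of_nonneg_right h1 hl
  refine le_trans (le_of_eq ?_) h2
  rw [extra]
  ring

theorem log_pow_cmp (a i j : ℕ) (ha : 0 < a) (h : 2 ^ i ≤ a ^ j) :
    (i : ℝ) * Real.log 2 ≤ j * Real.log a := by
  have : Real.log ((2 : ℝ) ^ i) ≤ Real.log ((a : ℝ) ^ j) :=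
    Real.log_le_log (by positivity) (by exact_mod_cast h)
  rwa [Real.log_pow, Real.log_pow] at this

theorem log_pow_cmp' (a i j : ℕ) (ha : 0 < a) (h : a ^ j ≤ 2 ^ i) :
    (j : ℝ) * Real.log a ≤ i * Real.log 2 := by
  have : Real.log ((a : ℝ) ^ j) ≤ Real.log ((2 : ℝ) ^ i) :=
    Real.log_le_log (by positivity) (by exact_mod_cast h)
  rwa [Real.log_pow, Real.log_pow] at this

theorem extra_lower (n : ℕ) :
    0.641 * (n : ℝ) - 15 ≤ extra n 2 + extra n 3 + extra n 5 + extra n 7 := by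
  have e2 : extra n 2 = (n * (127 / 256) - 7) * Real.log 2 := by
    simp [extra, mm, Finset.sum_Ico_succ_top]; left; ring
  have e3 : extra n 3 = (n * (40 / 243) - 4) * Real.log 3 := by
    simp [extra, mm, Finset.sum_Ico_succ_top]; left; ring
  have e5 : extra n 5 = (n * (6 / 125) - 2) * Real.log 5 := by
    simp [extra, mm, Finset.sum_Ico_succ_top]; left; ring
  have e7 : extra n 7 = (n * (1 / 49) - 1) * Real.log 7 := by
    simp [extra, mm]; left; ring
  have l2 := Real.log_two_gt_d9
  have l2' := Real.log_two_lt_d9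
  have l3 := log_pow_cmp 3 19 12 (by norm_num) (by norm_num)
  have l3' := log_pow_cmp' 3 8 5 (by norm_num) (by norm_num)
  have l5 := log_pow_cmp 5 65 28 (by norm_num) (by norm_num)
  have l5' := log_pow_cmp' 5 7 3 (by norm_num) (by norm_num)
  have l7 := log_pow_cmp 7 14 5 (by norm_num) (by norm_num)
  have l7' := log_pow_cmp' 7 3 1 (by norm_num) (by norm_num)
  push_cast at l3 l3' l5 l5' l7 l7'
  have hn : (0 : ℝ) ≤ n := by positivity
  have m2 : (n : ℝ) * 0.693147 ≤ n * Real.log 2 := by gcongr; linarith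
  have m3 : (n : ℝ) * 1.0974 ≤ n * Real.log 3 := by gcongr; linarith
  have m5 : (n : ℝ) * 1.609 ≤ n * Real.log 5 := by gcongr; linarith
  have m7 : (n : ℝ) * 1.94 ≤ n * Real.log 7 := by gcongr; linarith
  rw [e2, e3, e5, e7]
  nlinarith

theorem log_X : Real.log (8192 : ℝ) = 13 * Real.log 2 := by
  rw [show (8192 : ℝ) = 2 ^ 13 by norm_num, Real.log_pow]; norm_num

theorem sqrt_lower (n : ℕ) (hn : 8192 ≤ n) : (90.5 : ℝ) ≤ √(n : ℝ) := by
  have : (8192 : ℝ) ≤ n := by exact_mod_cast hn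
  apply Real.le_sqrt_of_sq_le
  norm_num; linarith

theorem log_le_sqrt (n : ℕ) (hn : 8192 ≤ n) : Real.log n ≤ 0.0996 * √(n : ℝ) := by
  have hn' : (8192 : ℝ) ≤ n := by exact_mod_cast hn
  have he : Real.exp 2 ≤ 8192 := by
    have h := Real.exp_one_lt_d9
    have h0 := Real.exp_pos 1
    rw [show (2 : ℝ) = 1 + 1 by norm_num, Real.exp_add]
    nlinarith
  have h := Real.log_div_sqrt_antitoneOn (Set.mem_Ici.2 he) (Set.mem_Ici.2 (he.trans hn')) hn'
  simp only at h
  have hs := sqrt_lower n hn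
  have h8 : (90.5 : ℝ) ≤ √(8192 : ℝ) := by
    have := sqrt_lower 8192 le_rfl
    exact_mod_cast this
  have h9 : Real.log (8192 : ℝ) / √(8192 : ℝ) ≤ 0.0996 := by
    rw [div_le_iff₀ (by linarith), log_X]
    have := Real.log_two_lt_d9
    linarith
  have := h.trans h9
  rwa [div_le_iff₀ (by linarith)] at this

theorem theta_lower (n : ℕ) (hn : 8192 ≤ n) : 0.49 * (n : ℝ) ≤ Chebyshev.theta (n : ℝ) := by
  have hn' : (8192 : ℝ) ≤ n := by exact_mod_cast hn
  have h1 := Chebyshev.theta_ge n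
  have h2 := log_le_sqrt n hn
  have h3 := sqrt_lower n hn
  have h4 : √(n : ℝ) * √(n : ℝ) = n := Real.mul_self_sqrt (by positivity)
  have h5 : Real.log ((n : ℝ) + 1) ≤ Real.log 2 + Real.log n := by
    rw [← Real.log_mul (by norm_num) (by positivity)]
    exact Real.log_le_log (by positivity) (by linarith)
  have l2 := Real.log_two_gt_d9
  have l2' := Real.log_two_lt_d9
  have h6 : 2 * √(n : ℝ) * Real.log n ≤ 0.1992 * n := by
    have := mul_le_mul_of_nonneg_left h2 (by positivity : 0 ≤ 2 * √(n : ℝ))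
    nlinarith
  have h7 : 0.69314 * (n : ℝ) ≤ n * Real.log 2 := by nlinarith
  nlinarith

theorem mertens (n : ℕ) (hn : 8192 ≤ n) : mA n ≤ Real.log n - 0.25 := by
  have hn' : (8192 : ℝ) ≤ n := by exact_mod_cast hn
  have h1 := mertens_raw n (by omega)
  have h2 := extra_lower n
  have h3 := Chebyshev.theta_le_log4_mul_x (x := (n : ℝ)) (by positivity)
  have h4 : Real.log 4 = 2 * Real.log 2 := by
    rw [show (4 : ℝ) = 2 ^ 2 by norm_num, Real.log_pow]; norm_num
  have h5 := log_le_sqrt n hn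
  have h6 := sqrt_lower n hn
  have h7 : √(n : ℝ) * √(n : ℝ) = n := Real.mul_self_sqrt (by positivity)
  have h8 : 90.5 * √(n : ℝ) ≤ n := by nlinarith
  have l2' := Real.log_two_lt_d9
  have h9 : Real.log 4 * (n : ℝ) ≤ 1.3863 * n := by
    rw [h4]; nlinarith
  have h10 : (n : ℝ) * mA n ≤ n * (Real.log n - 0.25) := by
    nlinarith
  exact le_of_mul_le_mul_left h10 (by linarith)

/-- `∑_{p ≤ n} 1 / p`. -/
noncomputable def mR (n : ℕ) : ℝ := ∑ p ∈ PS n, 1 / (p : ℝ)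

theorem abel (n : ℕ) (hn : 8192 ≤ n) :
    mR n + (-0.25 - mA n) / Real.log n - Real.log (Real.log n) ≤
      mR 8192 + (-0.25 - mA 8192) / Real.log (8192 : ℕ) - Real.log (Real.log (8192 : ℕ)) := by
  induction n, hn using Nat.le_induction with
  | base => exact le_rfl
  | succ n hn ih =>
    refine le_trans ?_ ih
    have hn' : (8192 : ℝ) ≤ n := by exact_mod_cast hn
    have hM := mertens n hn
    have hL : 0 < Real.log (n : ℝ) := Real.log_pos (by linarith)
    have hLL : Real.log (n : ℝ) ≤ Real.log ((n + 1 : ℕ) : ℝ) :=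
      Real.log_le_log (by linarith) (by push_cast; linarith)
    have hL' : 0 < Real.log ((n + 1 : ℕ) : ℝ) := by linarith
    have key : mR (n + 1) - mA (n + 1) / Real.log ((n + 1 : ℕ) : ℝ) =
        mR n - mA n / Real.log ((n + 1 : ℕ) : ℝ) := by
      by_cases hp : (n + 1).Prime
      · rw [mR, mA, PS_succ_prime hp, Finset.sum_insert (notMem_PS _),
          Finset.sum_insert (notMem_PS _), ← mR, ← mA]
        have : ((n + 1 : ℕ) : ℝ) ≠ 0 := by positivity
        field_simp
        ring
      · rw [mR, mA, PS_succ_not_prime hp, ← mR, ← mA]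
    generalize Real.log ((n + 1 : ℕ) : ℝ) = y at *
    generalize Real.log (n : ℝ) = x at *
    have h1 : 1 - x / y ≤ Real.log y - Real.log x := by
      have := Real.one_sub_inv_le_log_of_pos (x := y / x) (by positivity)
      rwa [Real.log_div hL'.ne' hL.ne', inv_div] at this
    have h2 : (-0.25 - mA n) / y - (-0.25 - mA n) / x ≤ 1 - x / y := by
      have e : 1 - x / y - ((-0.25 - mA n) / y - (-0.25 - mA n) / x) =
          (x - 0.25 - mA n) * (y - x) / (x * y) := by
        field_simp
        ring
      have : 0 ≤ (x - 0.25 - mA n) * (y - x) / (x * y) := by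
        apply div_nonneg _ (by positivity)
        exact mul_nonneg (by linarith) (by linarith)
      linarith
    have e1 : (-0.25 - mA (n + 1)) / y = -0.25 / y - mA (n + 1) / y := by ring
    have e2 : (-0.25 - mA n) / y = -0.25 / y - mA n / y := by ring
    linarith

theorem factor_nonneg (p : ℕ) : (0 : ℝ) ≤ 1 + 1 / (p : ℝ) := by positivity

theorem prod_upper (n : ℕ) (hn : 8192 ≤ n) :
    ∏ p ∈ PS n, (1 + 1 / (p : ℝ)) ≤ 1.227 * Real.log n := by
  have hn' : (8192 : ℝ) ≤ n := by exact_mod_cast hn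
  have hL : 0 < Real.log (n : ℝ) := Real.log_pos (by linarith)
  have l2 := Real.log_two_gt_d9
  have l2' := Real.log_two_lt_d9
  have hX : Real.log ((8192 : ℕ) : ℝ) = 13 * Real.log 2 := by exact_mod_cast log_X
  have hX0 : 0 < Real.log ((8192 : ℕ) : ℝ) := by rw [hX]; positivity
  have h1 := abel n hn
  have hM := mertens n hn
  have hA := st_A st_8192
  have hP := st_prod st_8192
  have h2 : -1 ≤ (-0.25 - mA n) / Real.log n := by
    rw [le_div_iff₀ hL]; linarith
  have h3 : (-0.25 - mA 8192) / Real.log (8192 : ℕ) ≤ -1 + 0.1235 := by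
    rw [div_le_iff₀ hX0, hX]
    norm_num at hA ⊢
    linarith
  have h4 : mR n - mR 8192 ≤ 0.1235 + (Real.log (Real.log n) - Real.log (Real.log (8192 : ℕ))) := by
    linarith
  have h5 : Real.exp (mR n - mR 8192) ≤ 1.1315 * (Real.log n / Real.log (8192 : ℕ)) := by
    refine (Real.exp_le_exp.2 h4).trans ?_
    rw [Real.exp_add, Real.exp_sub, Real.exp_log hL, Real.exp_log hX0]
    refine mul_le_mul_of_nonneg_right ?_ (by positivity)
    refine (Real.exp_bound' (by norm_num) (by norm_num) (n := 5) (by norm_num)).trans ?_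
    norm_num [Finset.sum_range_succ, Nat.factorial]
  have hsub := PS_mono hn
  have h6 : ∏ p ∈ PS n \ PS 8192, (1 + 1 / (p : ℝ)) ≤ Real.exp (mR n - mR 8192) := by
    have : mR n - mR 8192 = ∑ p ∈ PS n \ PS 8192, 1 / (p : ℝ) := by
      rw [mR, mR, ← Finset.sum_sdiff hsub]; ring
    rw [this, Real.exp_sum]
    refine Finset.prod_le_prod (fun p _ => factor_nonneg p) fun p _ => ?_
    have := Real.add_one_le_exp (1 / (p : ℝ))
    linarith
  rw [← Finset.prod_sdiff hsub]
  have h7 : (0 : ℝ) ≤ ∏ p ∈ PS 8192, (1 + 1 / (p : ℝ)) :=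
    Finset.prod_nonneg fun p _ => factor_nonneg p
  calc _ ≤ (1.1315 * (Real.log n / Real.log (8192 : ℕ))) * (9766021357 / 10 ^ 9) := by
        refine mul_le_mul (h6.trans h5) ?_ h7 (by positivity)
        exact_mod_cast hP
    _ = (1.1315 * (9766021357 / 10 ^ 9) / Real.log (8192 : ℕ)) * Real.log n := by ring
    _ ≤ _ := by
        refine mul_le_mul_of_nonneg_right ?_ hL.le
        rw [div_le_iff₀ hX0, hX]
        norm_num
        linarith

theorem goal_large (n : ℕ) (hn : 8192 ≤ n) : Goal n := by
  have hn' : (8192 : ℝ) ≤ n := by exact_mod_cast hn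
  have hL : 9 ≤ Real.log (n : ℝ) := by
    have h1 : Real.log (8192 : ℝ) ≤ Real.log n := Real.log_le_log (by norm_num) hn'
    rw [log_X] at h1
    have l2 := Real.log_two_gt_d9
    linarith
  have hth := theta_lower n hn
  have h49 : (-0.714 : ℝ) ≤ Real.log 0.49 := by
    rw [Real.le_log_iff_exp_le (by norm_num), Real.exp_neg]
    rw [inv_le_comm₀ (Real.exp_pos _) (by norm_num)]
    refine le_trans ?_ (Real.sum_le_exp_of_nonneg (by norm_num) 7)
    norm_num [Finset.sum_range_succ, Nat.factorial]
  have hu : Real.log n - 0.714 ≤ Real.log (Chebyshev.theta (n : ℝ)) := by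
    have h1 : Real.log (0.49 * (n : ℝ)) ≤ Real.log (Chebyshev.theta (n : ℝ)) :=
      Real.log_le_log (by positivity) hth
    rw [Real.log_mul (by norm_num) (by positivity)] at h1
    linarith
  refine F_mono (s := Real.log n - 0.714) (by linarith) hu ((prod_upper n hn).trans ?_)
  generalize Real.log (n : ℝ) = x at hL
  have hv : 0 < x - 0.714 := by linarith
  have : 1.766 * (x - 0.714) + 2.51 / (x - 0.714) =
    (1.766 * (x - 0.714) ^ 2 + 2.51) / (x - 0.714) := by field_simp
  rw [this, ← mul_div_assoc, le_div_iff₀ hv]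
  nlinarith

theorem prod_nth {α : Type*} [CommMonoid α] (g : ℕ → α) (k : ℕ) :
    ∏ i ∈ Finset.range k, g (Nat.nth Nat.Prime i) =
      ∏ p ∈ (Finset.range (Nat.nth Nat.Prime k)).filter Nat.Prime, g p := by
  induction k with
  | zero =>
    have : (Finset.range (Nat.nth Nat.Prime 0)).filter Nat.Prime = ∅ := by
      rw [Nat.nth_prime_zero_eq_two]; decide
    rw [this]; simp
  | succ k ih =>
    rw [Nat.filter_range_nth_eq_insert_of_infinite Nat.infinite_setOfPred_prime,
      Finset.prod_insert (by simp), Finset.prod_range_succ, ih, mul_comm]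

theorem primorial_product_sharp_bound (k : ℕ) (hk : 2 ≤ k) :
    ∏ i ∈ Finset.range k, (1 + 1 / (Nat.nth Nat.Prime i : ℝ)) ≤
      (3 / 4) * (Real.exp Real.eulerMascheroniConstant * Real.log (Real.log (Nk k)) +
        2.51 / Real.log (Real.log (Nk k))) := by
  have h5 : 5 ≤ Nat.nth Nat.Prime k := by
    rw [← Nat.nth_prime_two_eq_five]
    exact (Nat.nth_strictMono Nat.infinite_setOfPred_prime).monotone hk
  obtain ⟨n, hn⟩ : ∃ n, Nat.nth Nat.Prime k = n + 1 := ⟨Nat.nth Nat.Prime k - 1, by omega⟩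
  have e1 := prod_nth (fun p => 1 + 1 / (p : ℝ)) k
  have e2 : Real.log (Nk k) = Chebyshev.theta (n : ℝ) := by
    rw [theta_PS, Nk, prod_nth (fun p => p) k, hn, Nat.cast_prod,
      Real.log_prod (fun p hp => by exact_mod_cast (PS_prime (n := n) hp).ne_zero)]
    rfl
  have hG : Goal n := by
    rcases le_total n 8192 with h | h
    · exact goal_mid n (by omega) h
    · exact goal_large n h
  rw [e2]
  rw [e1, hn]
  exact hG
end

section
/- Every odd integer n ≥ 3 with n ∉ {3, 5, 9} satisfies σ(n)/n < e^γ · log(log n). -/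
open Real Finset

/-- product of `p/(p-1)` over odd primes below `m` -/
noncomputable def oddQ (m : ℕ) : ℝ :=
  ∏ p ∈ (range m).filter (fun p => p.Prime ∧ p ≠ 2), ((p : ℝ) / (p - 1))

/-- sum of `log p / p` over primes up to `N` -/
noncomputable def mertA (N : ℕ) : ℝ :=
  ∑ p ∈ (range (N + 1)).filter Nat.Prime, Real.log p / p

lemma sigma_le_prod (n : ℕ) (hn : n ≠ 0) :
    (ArithmeticFunction.sigma 1 n : ℝ) / n ≤ ∏ p ∈ n.primeFactors, ((p : ℝ) / (p - 1)) := by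
  have h1 : ArithmeticFunction.sigma 1 n = n.factorization.prod fun p k => ArithmeticFunction.sigma 1 (p ^ k) :=
    ArithmeticFunction.IsMultiplicative.multiplicative_factorization _
      ArithmeticFunction.isMultiplicative_sigma hn
  have h2 : (n : ℝ) = ∏ p ∈ n.primeFactors, (p : ℝ) ^ n.factorization p := by
    conv_lhs => rw [← Nat.prod_factorization_pow_eq_self hn]
    simp [Finsupp.prod]
  rw [h1]
  conv_lhs => rw [h2]
  simp only [Finsupp.prod, Nat.support_factorization, Nat.cast_prod]
  rw [← Finset.prod_div_distrib]
  apply Finset.prod_le_prod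
  · intros; positivity
  · intro p hp
    have hp' := Nat.prime_of_mem_primeFactors hp
    have hp2 : (2 : ℝ) ≤ p := by exact_mod_cast hp'.two_le
    rw [ArithmeticFunction.sigma_one_apply_prime_pow hp']
    push_cast
    rw [geom_sum_eq (by linarith), div_le_iff₀ (by positivity), div_le_iff₀ (by linarith)]
    have : (p : ℝ) / (p - 1) * p ^ n.factorization p * (p - 1) = p ^ (n.factorization p + 1) := by
      have : (p : ℝ) - 1 ≠ 0 := by linarith
      field_simp
      ring
    rw [this]; linarith

lemma threshold (n m : ℕ) (hodd : Odd n) (hm : 2 ≤ m) :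
    (ArithmeticFunction.sigma 1 n : ℝ) / n ≤
      oddQ m * Real.exp (Real.log n / ((m - 1) * Real.log m)) := by
  have hn : n ≠ 0 := by rintro rfl; simp at hodd
  have hm' : (2 : ℝ) ≤ m := by exact_mod_cast hm
  have hlm : 0 < Real.log m := Real.log_pos (by linarith)
  refine (sigma_le_prod n hn).trans ?_
  rw [← Finset.prod_filter_mul_prod_filter_not n.primeFactors (fun p => p < m)]
  have hfac : ∀ p : ℕ, p.Prime → 1 ≤ (p : ℝ) / (p - 1) := by
    intro p hp
    have hp2 : (2 : ℝ) ≤ p := by exact_mod_cast hp.two_le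
    rw [le_div_iff₀ (by linarith)]; linarith
  apply mul_le_mul
  · unfold oddQ
    have hsub : n.primeFactors.filter (fun p => p < m) ⊆
        (range m).filter (fun p => p.Prime ∧ p ≠ 2) := by
      intro p hp
      simp only [mem_filter, Nat.mem_primeFactors, mem_range] at hp ⊢
      refine ⟨hp.2, hp.1.1, ?_⟩
      rintro rfl
      exact (Nat.not_even_iff_odd.mpr hodd) (even_iff_two_dvd.mpr hp.1.2.1)
    rw [← Finset.prod_sdiff hsub]
    apply le_mul_of_one_le_left
    · apply Finset.prod_nonneg
      intro p hp
      simp only [mem_filter, Nat.mem_primeFactors] at hp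
      linarith [hfac p hp.1.1]
    · apply Finset.one_le_prod
      intro p hp
      simp only [mem_sdiff, mem_filter] at hp
      exact hfac p hp.1.2.1
  · have hlog : ∑ p ∈ n.primeFactors.filter (fun p => ¬ p < m), Real.log p ≤ Real.log n := by
      calc _ ≤ ∑ p ∈ n.primeFactors, Real.log p := by
            apply Finset.sum_le_sum_of_subset_of_nonneg (Finset.filter_subset _ _)
            intro p hp _
            exact Real.log_natCast_nonneg p
        _ = Real.log ((∏ p ∈ n.primeFactors, p : ℕ) : ℝ) := by
            push_cast
            rw [Real.log_prod]
            intro p hp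
            exact_mod_cast (Nat.prime_of_mem_primeFactors hp).ne_zero
        _ ≤ _ := by
            apply Real.log_le_log
            · exact_mod_cast Finset.prod_pos (fun p hp => (Nat.prime_of_mem_primeFactors hp).pos)
            · exact_mod_cast Nat.le_of_dvd (Nat.pos_of_ne_zero hn) (Nat.prod_primeFactors_dvd n)
    calc _ ≤ ∏ p ∈ n.primeFactors.filter (fun p => ¬ p < m),
            Real.exp (Real.log p / ((m - 1) * Real.log m)) := by
          apply Finset.prod_le_prod
          · intro p hp
            simp only [mem_filter] at hp
            linarith [hfac p (Nat.prime_of_mem_primeFactors hp.1)]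
          · intro p hp
            simp only [mem_filter, not_lt] at hp
            have hmp : (m : ℝ) ≤ p := by exact_mod_cast hp.2
            have e1 : (p : ℝ) / (p - 1) = 1 / (p - 1) + 1 := by
              have : (p : ℝ) - 1 ≠ 0 := by linarith
              field_simp; ring
            rw [e1]
            refine (Real.add_one_le_exp _).trans ?_
            apply Real.exp_le_exp.mpr
            have : Real.log m ≤ Real.log p := Real.log_le_log (by linarith) hmp
            calc (1 : ℝ) / (p - 1) ≤ 1 / (m - 1) :=
                  one_div_le_one_div_of_le (by linarith) (by linarith)
              _ = Real.log m / ((m - 1) * Real.log m) := by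
                  have : (m : ℝ) - 1 ≠ 0 := by linarith
                  field_simp
              _ ≤ _ := by
                  have : 0 < ((m : ℝ) - 1) * Real.log m := mul_pos (by linarith) hlm
                  gcongr
      _ = Real.exp ((∑ p ∈ n.primeFactors.filter (fun p => ¬ p < m), Real.log p) /
            ((m - 1) * Real.log m)) := by
          rw [← Real.exp_sum, Finset.sum_div]
      _ ≤ _ := by
          apply Real.exp_le_exp.mpr
          have : 0 < ((m : ℝ) - 1) * Real.log m := mul_pos (by linarith) hlm
          gcongr
  · apply Finset.prod_nonneg
    intro p hp
    simp only [mem_filter] at hp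
    linarith [hfac p (Nat.prime_of_mem_primeFactors hp.1)]
  · unfold oddQ
    apply Finset.prod_nonneg
    intro p hp
    simp only [mem_filter] at hp
    linarith [hfac p hp.2.1]

lemma gamma_lb : (1.74 : ℝ) < Real.exp Real.eulerMascheroniConstant := by
  have h := Real.eulerMascheroniSeq_lt_eulerMascheroniConstant 31
  have h2 : (0.56 : ℝ) < Real.eulerMascheroniSeq 31 := by
    unfold Real.eulerMascheroniSeq
    have : Real.log ((31 : ℕ) + 1 : ℝ) = 5 * Real.log 2 := by
      rw [show ((31 : ℕ) + 1 : ℝ) = 2 ^ 5 by norm_num, Real.log_pow]; norm_num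
    rw [this]
    have h3 : (harmonic 31 : ℝ) ≥ 4.027 := by
      have : harmonic 31 ≥ 4.027 := by
        simp only [harmonic, Finset.sum_range_succ, Finset.sum_range_zero]; norm_num
      have h4 : ((4.027 : ℚ) : ℝ) ≤ (harmonic 31 : ℝ) := by exact_mod_cast this
      norm_num at h4 ⊢
    have := Real.log_two_lt_d9
    linarith
  have : Real.exp 0.56 < Real.exp Real.eulerMascheroniConstant := Real.exp_lt_exp.mpr (by linarith)
  refine lt_trans ?_ this
  rw [show (0.56 : ℝ) = (100 : ℕ) * 0.0056 by norm_num, Real.exp_nat_mul]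
  calc (1.74 : ℝ) ≤ 0 + (0.0056 + 1)^100 := by norm_num
    _ < _ := ?_
  have h5 : (0.0056 : ℝ) + 1 < Real.exp 0.0056 := Real.add_one_lt_exp (by norm_num)
  rw [zero_add]
  exact pow_lt_pow_left₀ h5 (by norm_num) (by norm_num)

lemma log_fact_le (N : ℕ) (hN : 1 ≤ N) :
    Real.log (N.factorial) ≤ (N + 1) * Real.log N - N + 1 := by
  induction N, hN using Nat.le_induction with
  | base => simp
  | succ N hN ih =>
    have hN' : (1 : ℝ) ≤ N := by exact_mod_cast hN
    rw [Nat.factorial_succ]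
    push_cast
    rw [Real.log_mul (by positivity) (by positivity)]
    have h := Real.one_sub_inv_le_log_of_pos (x := ((N : ℝ) + 1) / N) (by positivity)
    rw [Real.log_div (by positivity) (by positivity), inv_div] at h
    have h2 : 1 ≤ ((N : ℝ) + 1) * (Real.log (N + 1) - Real.log N) := by
      calc (1 : ℝ) = (N + 1) * (1 - N / (N + 1)) := by field_simp; ring
        _ ≤ _ := by gcongr
    nlinarith

lemma sum_floor_le (M N : ℕ) (hN : N ≤ M) :
    ∑ p ∈ (range (M + 1)).filter Nat.Prime, ((N / p : ℕ) : ℝ) * Real.log p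
      ≤ Real.log (N.factorial) := by
  induction N with
  | zero => simp
  | succ N ih =>
    have ih := ih (by omega)
    rw [Nat.factorial_succ]
    push_cast
    rw [Real.log_mul (by positivity) (by positivity)]
    simp only [Nat.succ_div]
    have : ∑ p ∈ (range (M + 1)).filter Nat.Prime,
        (((N / p + if p ∣ N + 1 then 1 else 0 : ℕ)) : ℝ) * Real.log p
        = ∑ p ∈ (range (M + 1)).filter Nat.Prime, ((N / p : ℕ) : ℝ) * Real.log p
        + ∑ p ∈ (N + 1).primeFactors, Real.log p := by
      have e : (N + 1).primeFactors = ((range (M + 1)).filter Nat.Prime).filter (fun p => p ∣ N + 1) := by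
        ext p
        simp only [Nat.mem_primeFactors, mem_filter, mem_range]
        constructor
        · rintro ⟨h1, h2, -⟩
          have := Nat.le_of_dvd (by omega) h2
          exact ⟨⟨by omega, h1⟩, h2⟩
        · rintro ⟨⟨_, h1⟩, h2⟩
          exact ⟨h1, h2, by omega⟩
      rw [e, Finset.sum_filter (fun p => p ∣ N + 1), ← Finset.sum_add_distrib]
      apply Finset.sum_congr rfl
      intro p _
      split_ifs <;> push_cast <;> ring
    rw [this]
    have : ∑ p ∈ (N + 1).primeFactors, Real.log p ≤ Real.log ((N : ℝ) + 1) := by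
      calc _ = Real.log ((∏ p ∈ (N + 1).primeFactors, p : ℕ) : ℝ) := by
            push_cast
            rw [Real.log_prod]
            intro p hp
            exact_mod_cast (Nat.prime_of_mem_primeFactors hp).ne_zero
        _ ≤ _ := by
            apply Real.log_le_log
            · exact_mod_cast Finset.prod_pos (fun p hp => (Nat.prime_of_mem_primeFactors hp).pos)
            · exact_mod_cast Nat.le_of_dvd (Nat.succ_pos _) (Nat.prod_primeFactors_dvd (N + 1))
    linarith

lemma mert_le (N : ℕ) (hN : 128 ≤ N) : mertA N ≤ Real.log N + 0.433 := by
  have hN' : (128 : ℝ) ≤ N := by exact_mod_cast hN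
  have h1 := sum_floor_le N N le_rfl
  have h2 := log_fact_le N (by omega)
  have h3 : ∑ p ∈ (range (N + 1)).filter Nat.Prime, Real.log p ≤ Real.log 4 * N := by
    have := Chebyshev.theta_le_log4_mul_x (x := N) (by positivity)
    rw [Chebyshev.theta_eq_sum_Icc, Nat.floor_natCast] at this
    rwa [Nat.range_eq_Icc_zero_sub_one _ (by omega), Nat.add_sub_cancel]
  have h4 : N * mertA N ≤ ∑ p ∈ (range (N + 1)).filter Nat.Prime, ((N / p : ℕ) : ℝ) * Real.log p
      + ∑ p ∈ (range (N + 1)).filter Nat.Prime, Real.log p := by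
    unfold mertA
    rw [← Finset.sum_add_distrib, Finset.mul_sum]
    apply Finset.sum_le_sum
    intro p hp
    simp only [mem_filter] at hp
    have hp0 : (0 : ℝ) < p := by exact_mod_cast hp.2.pos
    have : (N : ℝ) / p ≤ ((N / p : ℕ) : ℝ) + 1 := by
      rw [div_le_iff₀ hp0]
      have := Nat.lt_mul_div_succ N hp.2.pos
      have h' : N ≤ (N / p + 1) * p := by nlinarith
      exact_mod_cast h'
    have hl : 0 ≤ Real.log p := Real.log_natCast_nonneg p
    calc (N : ℝ) * (Real.log p / p) = (N / p) * Real.log p := by ring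
      _ ≤ (((N / p : ℕ) : ℝ) + 1) * Real.log p := by gcongr
      _ = _ := by ring
  have h5 : Real.log N ≤ N / 128 - 1 + 7 * Real.log 2 := by
    have := Real.log_le_sub_one_of_pos (x := (N : ℝ) / 128) (by positivity)
    rw [Real.log_div (by positivity) (by norm_num),
      show (128 : ℝ) = 2 ^ 7 by norm_num, Real.log_pow] at this
    norm_num at this ⊢
    linarith
  have h6 := Real.log_two_lt_d9
  rw [Real.log_four_eq] at h3
  have h8 : (N : ℝ) * mertA N ≤ N * (Real.log N + 0.433) := by nlinarith
  exact le_of_mul_le_mul_left h8 (by linarith)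

lemma mert_succ (N : ℕ) : mertA (N + 1) =
    mertA N + if (N + 1).Prime then Real.log ((N + 1 : ℕ) : ℝ) / ((N + 1 : ℕ) : ℝ) else 0 := by
  unfold mertA
  rw [Finset.sum_filter, Finset.sum_range_succ, ← Finset.sum_filter]

lemma oddQ_pos (N : ℕ) : 0 < oddQ N := by
  unfold oddQ
  apply Finset.prod_pos
  intro p hp
  simp only [mem_filter] at hp
  have hp2 : (2 : ℝ) ≤ p := by exact_mod_cast hp.2.1.two_le
  apply div_pos <;> linarith

lemma oddQ_succ (N : ℕ) (hN : 3 ≤ N) : oddQ (N + 1) =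
    oddQ N * if N.Prime then (N : ℝ) / (N - 1) else 1 := by
  unfold oddQ
  rw [Finset.prod_filter, Finset.prod_range_succ, ← Finset.prod_filter]
  have : N ≠ 2 := by omega
  simp [this]

lemma oddQ_bound (N : ℕ) (hN : 128 ≤ N) :
    Real.log (oddQ (N + 1)) ≤ Real.log (oddQ 129) + Real.log (Real.log N)
      - Real.log (Real.log 128) + (Real.log 128 + 0.433 - mertA 128) / Real.log 129
      - (Real.log N + 0.433 - mertA N) / Real.log (N + 1) + 1 / 128 - 1 / N := by
  induction N, hN using Nat.le_induction with
  | base => norm_num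
  | succ N hN ih =>
    have hN' : (128 : ℝ) ≤ N := by exact_mod_cast hN
    have hD := mert_le (N + 1) (by omega)
    have hms := mert_succ N
    rw [oddQ_succ (N + 1) (by omega)]
    set D' := Real.log ((N + 1 : ℕ) : ℝ) + 0.433 - mertA (N + 1) with hD'
    have hD0 : 0 ≤ D' := by linarith
    have l0 : 0 < Real.log N := Real.log_pos (by linarith)
    have l1 : 0 < Real.log ((N : ℝ) + 1) := Real.log_pos (by linarith)
    have l2 : Real.log ((N : ℝ) + 1) ≤ Real.log ((N : ℝ) + 1 + 1) :=
      Real.log_le_log (by linarith) (by linarith)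
    have hd : D' / Real.log (((N + 1 : ℕ) : ℝ) + 1) ≤ D' / Real.log ((N : ℝ) + 1) := by
      push_cast
      gcongr
    have hll : (Real.log ((N : ℝ) + 1) - Real.log N) / Real.log ((N : ℝ) + 1) ≤
        Real.log (Real.log ((N : ℝ) + 1)) - Real.log (Real.log N) := by
      have := Real.one_sub_inv_le_log_of_pos (x := Real.log ((N : ℝ) + 1) / Real.log N) (by positivity)
      rw [Real.log_div (by positivity) (by positivity), inv_div] at this
      rwa [sub_div, div_self l1.ne']
    have hQ : Real.log (oddQ (N + 1) * if (N + 1).Prime then (((N + 1 : ℕ) : ℝ)) / (((N + 1 : ℕ) : ℝ) - 1) else 1)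
        ≤ Real.log (oddQ (N + 1)) + (mertA (N + 1) - mertA N) / Real.log ((N : ℝ) + 1)
          + (1 / N - 1 / ((N : ℝ) + 1)) := by
      rw [hms]
      split_ifs with hp
      · push_cast
        rw [Real.log_mul (oddQ_pos _).ne' (by simp; constructor <;> linarith)]
        have := Real.log_le_sub_one_of_pos (x := ((N : ℝ) + 1) / N) (by positivity)
        have e : (mertA N + Real.log ((N : ℝ) + 1) / (N + 1) - mertA N) / Real.log ((N : ℝ) + 1)
            = 1 / (N + 1) := by
          field_simp; ring
        have e2 : ((N : ℝ) + 1) / N - 1 = 1 / N := by field_simp; ring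
        rw [e, add_sub_cancel_right]
        linarith
      · have : 1 / ((N : ℝ) + 1) ≤ 1 / N := one_div_le_one_div_of_le (by linarith) (by linarith)
        simp at this ⊢
        linarith
    have e3 : (mertA (N + 1) - mertA N) / Real.log ((N : ℝ) + 1) =
       (Real.log N + 0.433 - mertA N) / Real.log (N + 1) - D' / Real.log (N + 1)
        + (Real.log ((N : ℝ) + 1) - Real.log N) / Real.log ((N : ℝ) + 1) := by
      rw [hD']; push_cast; ring
    push_cast at *
    linarith

lemma exp_ub (a : ℝ) (h : a < 200) : Real.exp a ≤ ((1 - a / 200)⁻¹) ^ 200 := by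
  have h1 : Real.exp a = Real.exp (a / 200) ^ 200 := by
    rw [← Real.exp_nat_mul]; congr 1; push_cast; ring
  rw [h1]
  have h2 := Real.add_one_le_exp (-(a / 200))
  rw [Real.exp_neg] at h2
  have h3 : 0 < 1 - a / 200 := by linarith
  have h4 : Real.exp (a / 200) ≤ (1 - a / 200)⁻¹ := by
    rw [le_inv_comm₀ (Real.exp_pos _) h3]; linarith
  exact pow_le_pow_left₀ (Real.exp_pos _).le h4 _

lemma oddQ_11 : oddQ 11 ≤ 2.1875 := by
  unfold oddQ
  rw [show (range 11).filter (fun p => p.Prime ∧ p ≠ 2) = {3, 5, 7} by decide +kernel]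
  norm_num

lemma oddQ_cast (m : ℕ) : oddQ m =
    ((∏ p ∈ (range m).filter (fun p => p.Prime ∧ p ≠ 2), ((p : ℚ) / (p - 1)) : ℚ) : ℝ) := by
  unfold oddQ; push_cast; rfl

lemma oddQ_47 : oddQ 47 ≤ 3.5281 := by
  rw [oddQ_cast]
  have : ∏ p ∈ (range 47).filter (fun p => p.Prime ∧ p ≠ 2), ((p : ℚ) / (p - 1)) ≤ 35281 / 10000 := by
    decide +kernel
  have h : _ ≤ (((35281 / 10000 : ℚ)) : ℝ) := Rat.cast_le.mpr this
  refine h.trans ?_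
  norm_num

lemma oddQ_129 : oddQ 129 ≤ 4.392 := by
  rw [oddQ_cast]
  have : ∏ p ∈ (range 129).filter (fun p => p.Prime ∧ p ≠ 2), ((p : ℚ) / (p - 1)) ≤ 4392 / 1000 := by
    decide +kernel
  have h : _ ≤ (((4392 / 1000 : ℚ)) : ℝ) := Rat.cast_le.mpr this
  refine h.trans ?_
  norm_num

lemma mertA_128 : 3.5488 ≤ mertA 128 := by
  have h : ∑ p ∈ (range 129).filter Nat.Prime, ((Nat.log 2 (p ^ 8) : ℚ) / (8 * p)) ≥ 512 / 100 := by
    decide +kernel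
  have h1 : ((512 / 100 : ℚ) : ℝ) ≤
    ((∑ p ∈ (range 129).filter Nat.Prime, ((Nat.log 2 (p ^ 8) : ℚ) / (8 * p)) : ℚ) : ℝ) := Rat.cast_le.mpr h
  push_cast at h1
  have h2 : (∑ p ∈ (range 129).filter Nat.Prime, ((Nat.log 2 (p ^ 8) : ℝ) / (8 * p))) * Real.log 2
      ≤ mertA 128 := by
    unfold mertA
    rw [Finset.sum_mul]
    apply Finset.sum_le_sum
    intro p hp
    simp only [mem_filter] at hp
    have hp0 : (0 : ℝ) < p := by exact_mod_cast hp.2.pos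
    have h3 : 2 ^ Nat.log 2 (p ^ 8) ≤ p ^ 8 := Nat.pow_log_le_self 2 (pow_ne_zero _ hp.2.ne_zero)
    have h4 : (2 : ℝ) ^ Nat.log 2 (p ^ 8) ≤ (p : ℝ) ^ 8 := by exact_mod_cast h3
    have h5 := Real.log_le_log (by positivity) h4
    rw [Real.log_pow, Real.log_pow] at h5
    rw [le_div_iff₀ hp0]
    have : (Nat.log 2 (p ^ 8) : ℝ) / (8 * p) * Real.log 2 * p
      = (Nat.log 2 (p ^ 8) : ℝ) * Real.log 2 / 8 := by field_simp
    rw [this]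
    push_cast at h5
    linarith
  have := Real.log_two_gt_d9
  nlinarith

lemma mid (n m : ℕ) (hodd : Odd n) (hm : 2 ≤ m) (l u q c lm ll : ℝ) (hl : l ≤ Real.log n)
    (hu : Real.log n ≤ u) (hq : oddQ m ≤ q) (hlm : lm ≤ Real.log m) (hlm0 : 0 < lm)
    (hc : u ≤ c * ((m - 1) * lm)) (hl0 : 0 < l) (hll : ll ≤ Real.log l) (hc0 : c < 200)
    (hfin : q * ((1 - c / 200)⁻¹) ^ 200 ≤ 1.74 * ll) :
    (ArithmeticFunction.sigma 1 n : ℝ) / n <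
      Real.exp Real.eulerMascheroniConstant * Real.log (Real.log n) := by
  have hm' : (2 : ℝ) ≤ m := by exact_mod_cast hm
  have hQ := oddQ_pos m
  have hlog : Real.log l ≤ Real.log (Real.log n) := Real.log_le_log hl0 hl
  have he : Real.exp (Real.log n / ((m - 1) * Real.log m)) ≤ ((1 - c / 200)⁻¹) ^ 200 := by
    refine le_trans (Real.exp_le_exp.mpr ?_) (exp_ub c hc0)
    have h1 : ((m : ℝ) - 1) * lm ≤ (m - 1) * Real.log m := by
      apply mul_le_mul_of_nonneg_left hlm; linarith
    have h0 : 0 < ((m : ℝ) - 1) * lm := mul_pos (by linarith) hlm0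
    rw [div_le_iff₀ (by linarith)]
    have hcpos : 0 < c := by
      by_contra hneg
      push Not at hneg
      nlinarith
    nlinarith
  have h1 := threshold n m hodd hm
  have h2 : oddQ m * Real.exp (Real.log n / ((m - 1) * Real.log m)) ≤ q * ((1 - c / 200)⁻¹) ^ 200 := by
    apply mul_le_mul hq he (Real.exp_pos _).le (by linarith)
  have h3 : 0 < Real.log (Real.log n) := by
    have : 0 < q * ((1 - c / 200)⁻¹) ^ 200 := lt_of_lt_of_le (mul_pos hQ (Real.exp_pos _)) h2
    linarith
  have := gamma_lb
  nlinarith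

lemma large (n : ℕ) (hodd : Odd n) (hl : 128 ≤ Real.log n) :
    (ArithmeticFunction.sigma 1 n : ℝ) / n <
      Real.exp Real.eulerMascheroniConstant * Real.log (Real.log n) := by
  set N := ⌊Real.log n⌋₊ with hN
  have hN1 : 128 ≤ N := Nat.le_floor (by exact_mod_cast hl)
  have hN' : (128 : ℝ) ≤ N := by exact_mod_cast hN1
  have hNL : (N : ℝ) ≤ Real.log n := Nat.floor_le (by linarith)
  have hLN : Real.log n < N + 1 := Nat.lt_floor_add_one _
  have h1 := threshold n (N + 1) hodd (by omega)
  have hb := oddQ_bound N hN1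
  have hD := mert_le N hN1
  have hA := mertA_128
  have hlog128 : Real.log 128 = 7 * Real.log 2 := by
    rw [show (128 : ℝ) = 2 ^ 7 by norm_num, Real.log_pow]; norm_num
  have g1 := Real.log_two_gt_d9
  have g2 := Real.log_two_lt_d9
  have hl129 : (4.852 : ℝ) ≤ Real.log 129 := by
    have : Real.log 128 ≤ Real.log 129 := Real.log_le_log (by norm_num) (by norm_num)
    linarith
  have hlN1 : (4.852 : ℝ) ≤ Real.log (N + 1) := by
    have : Real.log 128 ≤ Real.log (N + 1) := Real.log_le_log (by norm_num) (by linarith)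
    linarith
  have hlN : (4.852 : ℝ) ≤ Real.log N := by
    have : Real.log 128 ≤ Real.log N := Real.log_le_log (by norm_num) (by linarith)
    linarith
  have b1 : (Real.log 128 + 0.433 - mertA 128) / Real.log 129 ≤ 0.358 := by
    rw [div_le_iff₀ (by linarith)]; linarith
  have b2 : 0 ≤ (Real.log N + 0.433 - mertA N) / Real.log (N + 1) := by
    apply div_nonneg <;> linarith
  have b3 : (0 : ℝ) ≤ 1 / N := by positivity
  have b4 : Real.log n / ((((N + 1 : ℕ) : ℝ) - 1) * Real.log ((N + 1 : ℕ) : ℝ)) ≤ 0.208 := by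
    push_cast
    rw [add_sub_cancel_right, div_le_iff₀ (mul_pos (by linarith) (by linarith))]
    nlinarith
  have b5 : oddQ (N + 1) ≤ 4.392 / 4.852 * Real.log N * Real.exp 0.366 := by
    rw [← Real.exp_log (oddQ_pos (N + 1))]
    have hx : 4.392 / 4.852 * Real.log N * Real.exp 0.366 =
        Real.exp (Real.log 4.392 - Real.log 4.852 + Real.log (Real.log N) + 0.366) := by
      rw [Real.exp_add, Real.exp_add, Real.exp_sub, Real.exp_log (by norm_num),
        Real.exp_log (by norm_num), Real.exp_log (by linarith)]
    rw [hx]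
    apply Real.exp_le_exp.mpr
    have c1 : Real.log (oddQ 129) ≤ Real.log 4.392 := Real.log_le_log (oddQ_pos _) oddQ_129
    have c2 : Real.log 4.852 ≤ Real.log (Real.log 128) := Real.log_le_log (by norm_num) (by linarith)
    linarith
  have b6 : Real.exp 0.366 * Real.exp 0.208 ≤ 1.9 := by
    rw [← Real.exp_add]
    refine (exp_ub _ (by norm_num)).trans ?_
    norm_num
  have b7 : oddQ (N + 1) * Real.exp (Real.log n / ((((N + 1 : ℕ) : ℝ) - 1) * Real.log ((N + 1 : ℕ) : ℝ)))
      ≤ 4.392 / 4.852 * Real.log N * Real.exp 0.366 * Real.exp 0.208 := by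
    apply mul_le_mul b5 (Real.exp_le_exp.mpr b4) (Real.exp_pos _).le
    have := oddQ_pos (N + 1)
    linarith
  have b8 : Real.log N ≤ Real.log (Real.log n) := Real.log_le_log (by linarith) hNL
  have := gamma_lb
  have b9 : 4.392 / 4.852 * Real.log N * Real.exp 0.366 * Real.exp 0.208
      ≤ 4.392 / 4.852 * Real.log N * 1.9 := by
    rw [mul_assoc]
    apply mul_le_mul_of_nonneg_left b6
    apply mul_nonneg (by norm_num); linarith
  have b10 : 1.74 * Real.log (Real.log n) < Real.exp Real.eulerMascheroniConstant * Real.log (Real.log n) := by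
    apply mul_lt_mul_of_pos_right this; linarith
  nlinarith

lemma tiny (n k : ℕ) (s ll : ℝ) (hk : k ≤ n) (hk2 : 2 ≤ k) (hs : (ArithmeticFunction.sigma 1 n : ℝ) ≤ s * n)
    (hll : ((1 - (s / 1.74) / 200)⁻¹) ^ 200 ≤ ll) (hs2 : s / 1.74 < 200) (hs0 : 0 < s)
    (hl : ll ≤ Real.log k) :
    (ArithmeticFunction.sigma 1 n : ℝ) / n <
      Real.exp Real.eulerMascheroniConstant * Real.log (Real.log n) := by
  have hk' : (2 : ℝ) ≤ k := by exact_mod_cast hk2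
  have hn' : (k : ℝ) ≤ n := by exact_mod_cast hk
  have h1 : Real.log k ≤ Real.log n := Real.log_le_log (by linarith) hn'
  have h2 := exp_ub _ hs2
  have h3 : s / 1.74 ≤ Real.log (Real.log n) := by
    rw [Real.le_log_iff_exp_le]
    · linarith
    · have : 0 < Real.log k := Real.log_pos (by linarith)
      linarith
  have h4 : (ArithmeticFunction.sigma 1 n : ℝ) / n ≤ s := by
    rw [div_le_iff₀ (by linarith)]; exact hs
  have h5 : s ≤ 1.74 * Real.log (Real.log n) := by
    rw [div_le_iff₀ (by norm_num)] at h3; linarith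
  have h6 := gamma_lb
  have h7 : 1.74 * Real.log (Real.log n) < Real.exp Real.eulerMascheroniConstant * Real.log (Real.log n) := by
    apply mul_lt_mul_of_pos_right h6
    have : 0 < s / 1.74 := by positivity
    linarith
  linarith

lemma sig_a : ∀ n < 105, 19 ≤ n → n % 2 = 1 → 100 * (∑ d ∈ (range (n + 1)).filter (· ∣ n), d) ≤ 184 * n := by
  decide +kernel

lemma sig_b : ∀ n < 404, 105 ≤ n → n % 2 = 1 → 10 * (∑ d ∈ (range (n + 1)).filter (· ∣ n), d) ≤ 21 * n := by
  decide +kernel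

lemma sig_eq (n : ℕ) (hn : n ≠ 0) :
    ArithmeticFunction.sigma 1 n = ∑ d ∈ (range (n + 1)).filter (· ∣ n), d := by
  rw [ArithmeticFunction.sigma_one_apply]
  apply Finset.sum_congr _ (fun _ _ => rfl)
  ext d
  simp only [Nat.mem_divisors, mem_filter, mem_range]
  constructor
  · rintro ⟨h1, h2⟩
    exact ⟨Nat.lt_succ_of_le (Nat.le_of_dvd (Nat.pos_of_ne_zero hn) h1), h1⟩
  · rintro ⟨_, h⟩; exact ⟨h, hn⟩

lemma small_n (n : ℕ) (hn : 3 ≤ n) (hodd : Odd n) (hne : n ∉ ({3, 5, 9} : Set ℕ)) (hlt : n < 404) :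
    (ArithmeticFunction.sigma 1 n : ℝ) / n <
      Real.exp Real.eulerMascheroniConstant * Real.log (Real.log n) := by
  have ho : n % 2 = 1 := Nat.odd_iff.mp hodd
  have g2 := Real.log_two_gt_d9
  have g3 := Real.log_three_gt_d9
  have g5 := Real.log_five_gt_d9
  have hse := sig_eq n (by omega)
  by_cases h19 : n < 19
  · have l7 : (1.935 : ℝ) ≤ Real.log (7 : ℕ) := by
      have h : Real.log ((2 : ℝ) ^ 4 * 3) ≤ Real.log ((7 : ℝ) ^ 2) :=
        Real.log_le_log (by norm_num) (by norm_num)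
      rw [Real.log_mul (by norm_num) (by norm_num), Real.log_pow, Real.log_pow] at h
      push_cast at *
      linarith
    simp only [Set.mem_insert_iff, Set.mem_singleton_iff, not_or] at hne
    have hcases : n = 7 ∨ n = 11 ∨ n = 13 ∨ n = 17 ∨ n = 15 := by omega
    by_cases h15 : n = 15
    · subst h15
      have hv : ArithmeticFunction.sigma 1 15 = 24 := by rw [hse]; decide +kernel
      apply tiny 15 15 1.6 2.7 le_rfl (by norm_num) (by rw [hv]; norm_num) (by norm_num) (by norm_num)
        (by norm_num)
      rw [show ((15 : ℕ) : ℝ) = 3 * 5 by norm_num, Real.log_mul (by norm_num) (by norm_num)]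
      linarith
    · have hv : 7 * ArithmeticFunction.sigma 1 n ≤ 8 * n := by
        rw [hse]
        rcases hcases with rfl | rfl | rfl | rfl | rfl
        all_goals first | decide +kernel | omega
      have hv' : (7 : ℝ) * (ArithmeticFunction.sigma 1 n : ℕ) ≤ 8 * n := by exact_mod_cast hv
      apply tiny n 7 (8 / 7) 1.935 (by omega) (by norm_num) (by linarith) (by norm_num) (by norm_num)
        (by norm_num) l7
  · by_cases h105 : n < 105
    · have hv := sig_a n h105 (by omega) ho
      rw [← hse] at hv
      have hv' : (100 : ℝ) * (ArithmeticFunction.sigma 1 n : ℕ) ≤ 184 * n := by exact_mod_cast hv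
      apply tiny n 19 1.84 2.943 (by omega) (by norm_num) (by linarith) (by norm_num) (by norm_num)
        (by norm_num)
      have h : Real.log ((2 : ℝ) ^ 3 * 3 ^ 2 * 5) ≤ Real.log ((19 : ℝ) ^ 2) :=
        Real.log_le_log (by norm_num) (by norm_num)
      rw [Real.log_mul (by norm_num) (by norm_num), Real.log_mul (by norm_num) (by norm_num),
        Real.log_pow, Real.log_pow, Real.log_pow] at h
      push_cast at *
      linarith
    · have hv := sig_b n hlt (by omega) ho
      rw [← hse] at hv
      have hv' : (10 : ℝ) * (ArithmeticFunction.sigma 1 n : ℕ) ≤ 21 * n := by exact_mod_cast hv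
      apply tiny n 64 2.1 4 (by omega) (by norm_num) (by linarith) (by norm_num) (by norm_num)
        (by norm_num)
      rw [show ((64 : ℕ) : ℝ) = 2 ^ 6 by norm_num, Real.log_pow]
      push_cast
      linarith

theorem odd_robin (n : ℕ) (hn : 3 ≤ n) (hodd : Odd n) (hne : n ∉ ({3, 5, 9} : Set ℕ)) :
    (ArithmeticFunction.sigma 1 n : ℝ) / n <
      Real.exp Real.eulerMascheroniConstant * Real.log (Real.log n) := by
  by_cases hlt : n < 404
  · exact small_n n hn hodd hne hlt
  have g2 := Real.log_two_gt_d9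
  have g3 := Real.log_three_gt_d9
  have g5 := Real.log_five_gt_d9
  have h6 : (6 : ℝ) ≤ Real.log n := by
    rw [Real.le_log_iff_exp_le (by positivity)]
    have h404 : (404 : ℝ) ≤ n := by exact_mod_cast (not_lt.mp hlt)
    have : Real.exp 6 = Real.exp 1 ^ 6 := by rw [← Real.exp_nat_mul]; norm_num
    rw [this]
    have : Real.exp 1 ^ 6 ≤ 2.7182818286 ^ 6 :=
      pow_le_pow_left₀ (Real.exp_pos _).le Real.exp_one_lt_d9.le _
    have h' : (2.7182818286 : ℝ) ^ 6 ≤ 404 := by norm_num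
    linarith
  have l2 : ∀ k : ℕ, Real.log ((2 : ℝ) ^ k) = k * Real.log 2 := fun k => by rw [Real.log_pow]
  have l11 : (2.3937 : ℝ) ≤ Real.log (11 : ℕ) := by
    have h : Real.log ((2 : ℝ) ^ 3 * 3 * 5) ≤ Real.log ((11 : ℝ) ^ 2) :=
      Real.log_le_log (by norm_num) (by norm_num)
    rw [Real.log_mul (by norm_num) (by norm_num), Real.log_mul (by norm_num) (by norm_num),
      Real.log_pow, Real.log_pow] at h
    push_cast at *
    linarith
  have l47 : (3.8066 : ℝ) ≤ Real.log (47 : ℕ) := by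
    have h : Real.log ((3 : ℝ) ^ 2 * 5) ≤ Real.log (47 : ℝ) :=
      Real.log_le_log (by norm_num) (by norm_num)
    rw [Real.log_mul (by norm_num) (by norm_num), Real.log_pow] at h
    push_cast at *
    linarith
  have m6 : (1.7917 : ℝ) ≤ Real.log 6 := by
    rw [show (6 : ℝ) = 2 * 3 by norm_num, Real.log_mul (by norm_num) (by norm_num)]; linarith
  have m8 : (2.0794 : ℝ) ≤ Real.log 8 := by
    rw [show (8 : ℝ) = 2 ^ 3 by norm_num, l2]; push_cast; linarith
  have m10 : (2.3 : ℝ) ≤ Real.log 10 := by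
    rw [Real.log_ten_eq]; linarith
  have m16 : (2.77 : ℝ) ≤ Real.log 16 := by
    rw [show (16 : ℝ) = 2 ^ 4 by norm_num, l2]; push_cast; linarith
  have m32 : (3.46 : ℝ) ≤ Real.log 32 := by
    rw [show (32 : ℝ) = 2 ^ 5 by norm_num, l2]; push_cast; linarith
  have m64 : (4.15 : ℝ) ≤ Real.log 64 := by
    rw [show (64 : ℝ) = 2 ^ 6 by norm_num, l2]; push_cast; linarith
  have m90 : (4.499 : ℝ) ≤ Real.log 90 := by
    rw [show (90 : ℝ) = 2 * 3 ^ 2 * 5 by norm_num, Real.log_mul (by norm_num) (by norm_num),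
      Real.log_mul (by norm_num) (by norm_num), Real.log_pow]
    push_cast; linarith
  rcases le_total (Real.log n) 8 with h | h8
  · exact mid n 11 hodd (by norm_num) 6 8 2.1875 0.3345 2.3937 1.7917 h6 h oddQ_11 l11
      (by norm_num) (by norm_num) (by norm_num) m6 (by norm_num) (by norm_num)
  rcases le_total (Real.log n) 10 with h | h10
  · exact mid n 11 hodd (by norm_num) 8 10 2.1875 0.42 2.3937 2.0794 h8 h oddQ_11 l11
      (by norm_num) (by norm_num) (by norm_num) m8 (by norm_num) (by norm_num)
  rcases le_total (Real.log n) 16 with h | h16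
  · exact mid n 47 hodd (by norm_num) 10 16 3.5281 0.0915 3.8066 2.3 h10 h oddQ_47 l47
      (by norm_num) (by norm_num) (by norm_num) m10 (by norm_num) (by norm_num)
  rcases le_total (Real.log n) 32 with h | h32
  · exact mid n 47 hodd (by norm_num) 16 32 3.5281 0.183 3.8066 2.77 h16 h oddQ_47 l47
      (by norm_num) (by norm_num) (by norm_num) m16 (by norm_num) (by norm_num)
  rcases le_total (Real.log n) 64 with h | h64
  · exact mid n 47 hodd (by norm_num) 32 64 3.5281 0.366 3.8066 3.46 h32 h oddQ_47 l47
      (by norm_num) (by norm_num) (by norm_num) m32 (by norm_num) (by norm_num)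
  rcases le_total (Real.log n) 90 with h | h90
  · exact mid n 47 hodd (by norm_num) 64 90 3.5281 0.515 3.8066 4.15 h64 h oddQ_47 l47
      (by norm_num) (by norm_num) (by norm_num) m64 (by norm_num) (by norm_num)
  rcases le_total (Real.log n) 128 with h | h128
  · exact mid n 47 hodd (by norm_num) 90 128 3.5281 0.732 3.8066 4.499 h90 h oddQ_47 l47
      (by norm_num) (by norm_num) (by norm_num) m90 (by norm_num) (by norm_num)
  exact large n hodd h128
end

section
/- Let n ≥ 3 be an integer with ω(n) ≤ 4. Then σ(n)/n ≥ e^γ · log(log n) if and only if n belongs to the set {3, 4, 5, 8, 9, 16, 6, 10, 12, 18, 20, 24, 36, 48, 72, 30, 60, 84, 120, 180, 240, 360, 720, 840, 2520, 5040}. -/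
open Real Finset

namespace RobinAux

lemma logLB (x y a D : ℕ) (hx : 0 < x) (hy : 0 < y) (hD : 0 < D)
    (h : 27182818286 ^ a * y ^ D ≤ x ^ D * 10000000000 ^ a) :
    (a : ℝ) / D ≤ Real.log ((x : ℝ) / y) := by
  have hx' : (0 : ℝ) < x := by exact_mod_cast hx
  have hy' : (0 : ℝ) < y := by exact_mod_cast hy
  have hD' : (0 : ℝ) < D := by exact_mod_cast hD
  have h' : (27182818286 : ℝ) ^ a * (y : ℝ) ^ D ≤ (x : ℝ) ^ D * 10000000000 ^ a := by
    exact_mod_cast h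
  have h1 : Real.exp a ≤ ((x : ℝ) / y) ^ D := by
    have e1 : Real.exp a = Real.exp 1 ^ a := by rw [← Real.exp_nat_mul]; simp
    rw [e1]
    calc Real.exp 1 ^ a ≤ (27182818286 / 10000000000 : ℝ) ^ a := by
          apply pow_le_pow_left₀ (Real.exp_pos 1).le
          have := Real.exp_one_lt_d9
          norm_num at this ⊢
          linarith
      _ ≤ ((x : ℝ) / y) ^ D := by
          rw [div_pow, div_pow, div_le_div_iff₀ (by positivity) (by positivity)]
          exact h'
  rw [div_le_iff₀ hD', mul_comm, ← Real.log_pow, Real.le_log_iff_exp_le (by positivity)]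
  exact h1

lemma logUB (x y a D : ℕ) (hx : 0 < x) (hy : 0 < y) (hD : 0 < D)
    (h : x ^ D * 10000000000 ^ a ≤ 27182818283 ^ a * y ^ D) :
    Real.log ((x : ℝ) / y) ≤ (a : ℝ) / D := by
  have hx' : (0 : ℝ) < x := by exact_mod_cast hx
  have hy' : (0 : ℝ) < y := by exact_mod_cast hy
  have hD' : (0 : ℝ) < D := by exact_mod_cast hD
  have h' : (x : ℝ) ^ D * 10000000000 ^ a ≤ (27182818283 : ℝ) ^ a * (y : ℝ) ^ D := by
    exact_mod_cast h
  have h1 : ((x : ℝ) / y) ^ D ≤ Real.exp a := by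
    have e1 : Real.exp a = Real.exp 1 ^ a := by rw [← Real.exp_nat_mul]; simp
    rw [e1]
    calc ((x : ℝ) / y) ^ D ≤ (27182818283 / 10000000000 : ℝ) ^ a := by
          rw [div_pow, div_pow, div_le_div_iff₀ (by positivity) (by positivity)]
          exact h'
      _ ≤ Real.exp 1 ^ a := by
          apply pow_le_pow_left₀ (by norm_num)
          have := Real.exp_one_gt_d9
          norm_num at this ⊢
          linarith
  rw [le_div_iff₀ hD', mul_comm, ← Real.log_pow, Real.log_le_iff_le_exp (by positivity)]
  exact h1

/-! Bounds for the Euler–Mascheroni constant -/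

def hl : ℕ → ℕ
  | 0 => 0
  | n + 1 => hl n + 1000000000000 / (n + 1)

lemma hl_le (n : ℕ) : ((hl n : ℕ) : ℝ) ≤ 1000000000000 * (harmonic n : ℝ) := by
  induction n with
  | zero => simp [hl]
  | succ n ih =>
    have : ((1000000000000 / (n + 1) : ℕ) : ℝ) ≤ 1000000000000 / ((n : ℝ) + 1) := by
      have := @Nat.cast_div_le ℝ _ _ _ 1000000000000 (n + 1)
      push_cast at this ⊢
      exact this
    simp only [hl, harmonic_succ]
    push_cast at this ⊢
    rw [mul_add, ← div_eq_mul_inv]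
    linarith

lemma le_hl (n : ℕ) : 1000000000000 * (harmonic n : ℝ) ≤ ((hl n : ℕ) : ℝ) + n := by
  induction n with
  | zero => simp [hl]
  | succ n ih =>
    have : 1000000000000 / ((n : ℝ) + 1) ≤ ((1000000000000 / (n + 1) : ℕ) : ℝ) + 1 := by
      rw [div_le_iff₀ (by positivity)]
      have := Nat.lt_div_mul_add (a := 1000000000000) (b := n + 1) (Nat.succ_pos n)
      have h2 : (1000000000000 : ℕ) ≤ (1000000000000 / (n + 1) + 1) * (n + 1) := by
        rw [add_mul]; omega
      exact_mod_cast h2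
    simp only [hl, harmonic_succ]
    push_cast at this ⊢
    rw [mul_add, ← div_eq_mul_inv]
    linarith

lemma hl_2047 : hl 2047 = 8201590489649 := by decide +kernel
lemma hl_2048 : hl 2048 ≤ 8202078772947 - 2048 := by decide +kernel

lemma log_2048 : Real.log 2048 = 11 * Real.log 2 := by
  rw [show (2048 : ℝ) = 2 ^ 11 by norm_num, Real.log_pow]; norm_num

lemma gamma_gt : (5769 : ℝ) / 10000 < Real.eulerMascheroniConstant := by
  have h := Real.eulerMascheroniSeq_lt_eulerMascheroniConstant 2047
  have h1 := hl_le 2047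
  rw [hl_2047] at h1
  unfold Real.eulerMascheroniSeq at h
  rw [show ((2047 : ℕ) : ℝ) + 1 = 2048 by norm_num, log_2048] at h
  have := Real.log_two_lt_d9
  generalize (harmonic 2047 : ℝ) = H at *
  push_cast at h1
  norm_num at this
  linarith

lemma gamma_lt : Real.eulerMascheroniConstant < (5775 : ℝ) / 10000 := by
  have h := Real.eulerMascheroniConstant_lt_eulerMascheroniSeq' 2048
  have h1 := le_hl 2048
  have h2 : ((hl 2048 : ℕ) : ℝ) ≤ ((8202078772947 - 2048 : ℕ) : ℝ) := by exact_mod_cast hl_2048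
  unfold Real.eulerMascheroniSeq' at h
  rw [if_neg (by norm_num), show ((2048 : ℕ) : ℝ) = 2048 by norm_num, log_2048] at h
  have := Real.log_two_gt_d9
  generalize (harmonic 2048 : ℝ) = H at *
  generalize ((hl 2048 : ℕ) : ℝ) = K at *
  norm_num at this h1 h2
  linarith

lemma pw1 : 17805 ^ 10000 * 10000000000 ^ 5769 ≤ 27182818283 ^ 5769 * 10000 ^ 10000 := by
  decide +kernel
lemma pw2 : 27182818286 ^ 5775 * 10000 ^ 10000 ≤ 17816 ^ 10000 * 10000000000 ^ 5775 := by
  decide +kernel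

lemma eg_gt : (17805 : ℝ) / 10000 < Real.exp Real.eulerMascheroniConstant := by
  rw [← Real.log_lt_iff_lt_exp (by norm_num)]
  have := logUB 17805 10000 5769 10000 (by norm_num) (by norm_num) (by norm_num) pw1
  have h2 := gamma_gt
  push_cast at this
  linarith

lemma eg_lt : Real.exp Real.eulerMascheroniConstant < (17816 : ℝ) / 10000 := by
  rw [← Real.lt_log_iff_exp_lt (by norm_num)]
  have := logLB 17816 10000 5775 10000 (by norm_num) (by norm_num) (by norm_num) pw2
  have h2 := gamma_lt
  push_cast at this
  linarith

/-! Bounds for `log (log N)` -/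

def lbOK (N a b : ℕ) : Bool :=
  Nat.ble (27182818286 ^ a) (N ^ 2000 * 10000000000 ^ a) &&
  Nat.ble (27182818286 ^ b * 2000 ^ 2000) (a ^ 2000 * 10000000000 ^ b) && Nat.ble 1 a && Nat.ble 1 N

def ubOK (N a b : ℕ) : Bool :=
  Nat.ble (N ^ 2000 * 10000000000 ^ a) (27182818283 ^ a) &&
  Nat.ble (a ^ 2000 * 10000000000 ^ b) (27182818283 ^ b * 2000 ^ 2000) && Nat.ble 1 a && Nat.ble 2 N

lemma lb_sound (N a b n : ℕ) (h : lbOK N a b = true) (hn : N ≤ n) :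
    (b : ℝ) / 2000 ≤ Real.log (Real.log n) := by
  simp only [lbOK, Bool.and_eq_true, Nat.ble_eq] at h
  obtain ⟨⟨⟨h1, h2⟩, h3⟩, h4⟩ := h
  have k1 := logLB N 1 a 2000 (by omega) (by norm_num) (by norm_num) (by rw [one_pow, mul_one]; exact h1)
  have k2 := logLB a 2000 b 2000 (by omega) (by norm_num) (by norm_num) h2
  have hN : (0 : ℝ) < N := by exact_mod_cast h4
  have ha : (0 : ℝ) < a := by exact_mod_cast h3
  have hn' : (N : ℝ) ≤ n := by exact_mod_cast hn
  simp only [Nat.cast_one, div_one] at k1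
  push_cast at k1 k2
  refine k2.trans (Real.log_le_log (by positivity) (k1.trans (Real.log_le_log hN hn')))

lemma ub_sound (N a b : ℕ) (h : ubOK N a b = true) :
    Real.log (Real.log N) ≤ (b : ℝ) / 2000 := by
  simp only [ubOK, Bool.and_eq_true, Nat.ble_eq] at h
  obtain ⟨⟨⟨h1, h2⟩, h3⟩, h4⟩ := h
  have k1 := logUB N 1 a 2000 (by omega) (by norm_num) (by norm_num) (by rw [one_pow, mul_one]; exact h1)
  have k2 := logUB a 2000 b 2000 (by omega) (by norm_num) (by norm_num) h2
  have hN : (1 : ℝ) < N := by exact_mod_cast h4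
  simp only [Nat.cast_one, div_one] at k1
  push_cast at k1 k2
  exact (Real.log_le_log (Real.log_pos hN) k1).trans k2

/-! A fast upper bound for `σ` -/

def tm (n k : ℕ) : ℕ :=
  cond (Nat.beq (n % k) 0) (cond (Nat.ble (k * k) n) (k + cond (Nat.ble n (k * k)) 0 (n / k)) 0) 0

def sg (n : ℕ) : ℕ → ℕ
  | 0 => 0
  | k + 1 => sg n k + tm n (k + 1)

lemma sg_eq (n r : ℕ) : sg n r = ∑ d ∈ Finset.Icc 1 r, tm n d := by
  induction r with
  | zero => simp [sg]
  | succ r ih => rw [sg, ih, Finset.sum_Icc_succ_top (by omega)]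

lemma sigma_le_sg (n r : ℕ) (hr : n < (r + 1) * (r + 1)) :
    ArithmeticFunction.sigma 1 n ≤ sg n r := by
  rw [ArithmeticFunction.sigma_one_apply, sg_eq]
  have e1 : ∑ d ∈ n.divisors, d = ∑ d ∈ n.divisors, (if d * d ≤ n then d else 0) +
      ∑ d ∈ n.divisors, (if n < d * d then d else 0) := by
    rw [← Finset.sum_add_distrib]
    refine Finset.sum_congr rfl fun d _ => ?_
    split_ifs <;> omega
  rw [e1, ← Nat.sum_div_divisors n (fun d => if n < d * d then d else 0), ← Finset.sum_add_distrib]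
  have key : ∀ d ∈ n.divisors, (if d * d ≤ n then d else 0) +
      (if n < (n / d) * (n / d) then n / d else 0) ≤ if d ≤ r then tm n d else 0 := by
    intro d hd
    have hdn : d ∣ n := Nat.dvd_of_mem_divisors hd
    have hd0 : 0 < d := Nat.pos_of_mem_divisors hd
    have hm : d * (n / d) = n := Nat.mul_div_cancel' hdn
    have hmod : n % d = 0 := Nat.mod_eq_zero_of_dvd hdn
    have hlt : n < (n / d) * (n / d) → d * d < n := by
      intro h
      have h' : d < n / d := by
        by_contra hcon
        have := Nat.mul_le_mul_right (n / d) (not_lt.mp hcon)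
        omega
      have := Nat.mul_lt_mul_of_pos_left h' hd0
      omega
    by_cases h1 : d * d ≤ n
    · have hdr : d ≤ r := by
        by_contra hcon
        have : (r + 1) * (r + 1) ≤ d * d := Nat.mul_le_mul (by omega) (by omega)
        omega
      have hb : Nat.ble (d * d) n = true := by rw [Nat.ble_eq]; exact h1
      have ht : tm n d = d + cond (Nat.ble n (d * d)) 0 (n / d) := by simp [tm, hmod, hb]
      rw [if_pos h1, if_pos hdr, ht]
      by_cases h2 : n < (n / d) * (n / d)
      · have hb : Nat.ble n (d * d) = false := by
          rw [← Bool.not_eq_true, Nat.ble_eq]; exact not_le.mpr (hlt h2)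
        rw [if_pos h2, hb]; simp
      · rw [if_neg h2]; omega
    · have : ¬ n < (n / d) * (n / d) := fun h => h1 (hlt h).le
      simp [h1, this]
  refine (Finset.sum_le_sum key).trans ?_
  rw [← Finset.sum_filter]
  refine Finset.sum_le_sum_of_subset ?_
  intro d hd
  rw [Finset.mem_filter] at hd
  rw [Finset.mem_Icc]
  exact ⟨Nat.pos_of_mem_divisors hd.1, hd.2⟩

def exc : List ℕ := [3, 4, 5, 8, 9, 16, 6, 10, 12, 18, 20, 24, 36, 48, 72,
            30, 60, 84, 120, 180, 240, 360, 720, 840, 2520, 5040]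

def P (n : ℕ) : Prop := n ∈ exc ∨
  (ArithmeticFunction.sigma 1 n : ℝ) / n <
    Real.exp Real.eulerMascheroniConstant * Real.log (Real.log n)

lemma P_of_bound (N a b n : ℕ) (h : lbOK N a b = true) (hN : N ≤ n)
    (hlt : (ArithmeticFunction.sigma 1 n : ℝ) / n < 17805 / 10000 * (b / 2000)) : P n := by
  right
  have h1 := lb_sound N a b n h hN
  refine hlt.trans_le ?_
  have : (0 : ℝ) ≤ b / 2000 := by positivity
  exact mul_le_mul eg_gt.le h1 this (Real.exp_pos _).le

def loop (s step b r : ℕ) : ℕ → Bool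
  | 0 => true
  | k + 1 => (Nat.blt (sg (s + k * step) r * 20000000) (17805 * b * (s + k * step)) ||
      exc.elem (s + k * step)) && loop s step b r k

lemma loop_sound (s step b r len : ℕ) (h : loop s step b r len = true) (i : ℕ) (hi : i < len) :
    sg (s + i * step) r * 20000000 < 17805 * b * (s + i * step) ∨ s + i * step ∈ exc := by
  induction len with
  | zero => omega
  | succ k ih =>
    simp only [loop, Bool.and_eq_true, Bool.or_eq_true, Nat.blt, Nat.ble_eq] at h
    rcases Nat.lt_succ_iff_lt_or_eq.mp hi with h1 | h1
    · exact ih h.2 h1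
    · subst h1
      rcases h.1 with h2 | h2
      · left; exact h2
      · right; simpa using h2

def cov (step : ℕ) : ℕ → List (ℕ × ℕ × ℕ × ℕ) → Bool
  | _, [] => true
  | s, (len, a, b, r) :: t => lbOK s a b && Nat.ble (s + len * step) ((r + 1) * (r + 1)) &&
      loop s step b r len && cov step (s + len * step) t

lemma cov_sound (step : ℕ) (hst : 0 < step) (l : List (ℕ × ℕ × ℕ × ℕ)) : ∀ (s : ℕ), 0 < s →
    cov step s l = true → ∀ i, i < (l.map (fun x => x.1)).sum → P (s + i * step) := by
  induction l with
  | nil => intro s _ _ i hi; simp at hi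
  | cons x t ih =>
    obtain ⟨len, a, b, r⟩ := x
    intro s hs h i hi
    simp only [cov, Bool.and_eq_true, Nat.ble_eq] at h
    obtain ⟨⟨⟨h1, h2⟩, h3⟩, h4⟩ := h
    simp only [List.map_cons, List.sum_cons] at hi
    by_cases hlt : i < len
    · rcases loop_sound _ _ _ _ _ h3 i hlt with h5 | h5
      · refine P_of_bound s a b _ h1 (by omega) ?_
        have h6 : s + i * step < s + len * step := by
          have := Nat.mul_lt_mul_of_pos_right hlt hst
          omega
        have h7 := sigma_le_sg (s + i * step) r (by omega)
        generalize s + i * step = n at *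
        have hn : 0 < n := by
          rcases Nat.eq_zero_or_pos n with h0 | h0
          · subst h0; simp at h5
          · exact h0
        have hn' : (0 : ℝ) < n := by exact_mod_cast hn
        have h8 : ArithmeticFunction.sigma 1 n * 20000000 < 17805 * b * n :=
          (Nat.mul_le_mul_right _ h7).trans_lt h5
        have h9 : (ArithmeticFunction.sigma 1 n : ℝ) * 20000000 < 17805 * b * n := by
          exact_mod_cast h8
        rw [div_lt_iff₀ hn']
        linarith
      · left; exact h5
    · have := ih (s + len * step) (by omega) h4 (i - len) (by omega)
      have e : s + len * step + (i - len) * step = s + i * step := by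
        rw [add_assoc, ← add_mul]; congr 2; omega
      rwa [e] at this

def l1 : List (ℕ × ℕ × ℕ × ℕ) :=
  [(7, 3891, 1331, 3), (14, 5278, 1940, 5), (12, 6664, 2407, 6), (40, 7377, 2610, 8),
   (64, 8764, 2955, 12), (24, 9939, 3206, 12), (168, 10247, 3267, 18), (84, 11634, 3521, 20),
   (660, 12080, 3596, 32), (180, 13969, 3887, 35), (420, 14277, 3931, 40)]
def l1' : List (ℕ × ℕ × ℕ × ℕ) :=
  [(280, 14853, 4010, 57), (474, 16239, 4188, 78)]
def l2 : List (ℕ × ℕ × ℕ × ℕ) :=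
  [(130, 17458, 4333, 100), (504, 18436, 4442, 158), (60, 20269, 4631, 164)]
def l3 : List (ℕ × ℕ × ℕ × ℕ) :=
  [(136, 20398, 4644, 235), (308, 21846, 4781, 346)]

lemma c1 : cov 1 7 l1 = true := by decide +kernel
lemma c1' : cov 6 1680 l1' = true := by decide +kernel
lemma c2 : cov 30 6180 l2 = true := by decide +kernel
lemma c3 : cov 210 26880 l3 = true := by decide +kernel

lemma b1' : lbOK 1680 14853 4010 = true := by decide +kernel
lemma b1 : lbOK 6200 17464 4333 = true := by decide +kernel
lemma b2 : lbOK 27000 20407 4645 = true := by decide +kernel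
lemma b3 : lbOK 120000 23390 4918 = true := by decide +kernel

lemma P1 (n : ℕ) (h : 7 ≤ n) (h2 : n < 1680) : P n := by
  have := cov_sound 1 (by norm_num) l1 7 (by norm_num) c1 (n - 7) (by simp [l1]; omega)
  rwa [show 7 + (n - 7) * 1 = n by omega] at this

lemma P1' (n : ℕ) (h : 1680 ≤ n) (h2 : n < 6200) (h3 : 6 ∣ n) : P n := by
  obtain ⟨k, rfl⟩ := h3
  have := cov_sound 6 (by norm_num) l1' 1680 (by norm_num) c1' (k - 280) (by simp [l1']; omega)
  rwa [show 1680 + (k - 280) * 6 = 6 * k by omega] at this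

lemma P2 (n : ℕ) (h : 6200 ≤ n) (h2 : n < 27000) (h3 : 30 ∣ n) : P n := by
  obtain ⟨k, rfl⟩ := h3
  have := cov_sound 30 (by norm_num) l2 6180 (by norm_num) c2 (k - 206) (by simp [l2]; omega)
  rwa [show 6180 + (k - 206) * 30 = 30 * k by omega] at this

lemma P3 (n : ℕ) (h : 27000 ≤ n) (h2 : n < 120000) (h3 : 210 ∣ n) : P n := by
  obtain ⟨k, rfl⟩ := h3
  have := cov_sound 210 (by norm_num) l3 26880 (by norm_num) c3 (k - 128) (by simp [l3]; omega)
  rwa [show 26880 + (k - 128) * 210 = 210 * k by omega] at this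

/-! The general bound -/

noncomputable def g (p : ℕ) : ℝ := p / (p - 1)

lemma g_anti {p q : ℕ} (hp : 2 ≤ p) (h : p ≤ q) : g q ≤ g p := by
  unfold g
  have hp' : (2 : ℝ) ≤ p := by exact_mod_cast hp
  have h' : (p : ℝ) ≤ q := by exact_mod_cast h
  rw [div_le_div_iff₀ (by linarith) (by linarith)]
  nlinarith

lemma one_le_g {p : ℕ} (hp : 2 ≤ p) : 1 ≤ g p := by
  unfold g
  have hp' : (2 : ℝ) ≤ p := by exact_mod_cast hp
  rw [le_div_iff₀ (by linarith)]
  linarith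

lemma sigma_le_prod (n : ℕ) (hn : 0 < n) :
    (ArithmeticFunction.sigma 1 n : ℝ) / n ≤ ∏ p ∈ n.primeFactors, g p := by
  induction n using Nat.recOnPosPrimePosCoprime with
  | prime_pow p k hp hk =>
    rw [Nat.primeFactors_prime_pow hk.ne' hp, Finset.prod_singleton,
      ArithmeticFunction.sigma_one_apply_prime_pow hp]
    have hp' : (2 : ℝ) ≤ p := by exact_mod_cast hp.two_le
    push_cast
    rw [geom_sum_eq (by linarith)]
    unfold g
    rw [div_div, div_le_div_iff₀ (by apply mul_pos <;> [linarith; positivity]) (by linarith), pow_succ]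
    have : (0 : ℝ) < (p : ℝ) ^ k := by positivity
    nlinarith
  | zero => omega
  | one => simp
  | coprime a b ha hb hab iha ihb =>
    rw [ArithmeticFunction.isMultiplicative_sigma.map_mul_of_coprime hab,
      hab.primeFactors_mul, Finset.prod_union hab.disjoint_primeFactors]
    push_cast
    rw [mul_div_mul_comm]
    refine mul_le_mul (iha (by omega)) (ihb (by omega)) (by positivity) ?_
    refine Finset.prod_nonneg fun p hp => ?_
    linarith [one_le_g (Nat.prime_of_mem_primeFactors hp).two_le]

lemma prod_le (S T : Finset ℕ) (M : ℕ) (hS : ∀ p ∈ S, 2 ≤ p) (hT : ∀ p ∈ T, 2 ≤ p) (hM : 2 ≤ M)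
    (h1 : ∀ p ∈ S, p ∉ T → M ≤ p) (h2 : ∀ p ∈ T, p ≤ M) (hc : S.card ≤ T.card) :
    ∏ p ∈ S, g p ≤ ∏ p ∈ T, g p := by
  have gM := one_le_g hM
  have a1 : ∏ p ∈ S \ T, g p ≤ g M ^ (S \ T).card := by
    rw [← Finset.prod_const]
    refine Finset.prod_le_prod (fun p hp => ?_) fun p hp => ?_
    · rw [Finset.mem_sdiff] at hp
      linarith [one_le_g (hS p hp.1)]
    · rw [Finset.mem_sdiff] at hp
      exact g_anti hM (h1 p hp.1 hp.2)
  have a2 : g M ^ (T \ S).card ≤ ∏ p ∈ T \ S, g p := by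
    rw [← Finset.prod_const]
    refine Finset.prod_le_prod (fun p _ => by linarith) fun p hp => ?_
    rw [Finset.mem_sdiff] at hp
    exact g_anti (hT p hp.1) (h2 p hp.1)
  have a3 : (S \ T).card ≤ (T \ S).card := by
    have := Finset.card_sdiff_add_card_inter S T
    have := Finset.card_sdiff_add_card_inter T S
    rw [Finset.inter_comm T S] at this
    omega
  have a4 : g M ^ (S \ T).card ≤ g M ^ (T \ S).card := pow_le_pow_right₀ gM a3
  rw [← Finset.prod_inter_mul_prod_sdiff S T, ← Finset.prod_inter_mul_prod_sdiff T S,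
    Finset.inter_comm T S]
  refine mul_le_mul_of_nonneg_left (a1.trans (a4.trans a2)) ?_
  refine Finset.prod_nonneg fun p hp => ?_
  linarith [one_le_g (hS p (Finset.mem_inter.mp hp).1)]

lemma two_le_of_mem {n p : ℕ} (hp : p ∈ n.primeFactors) : 2 ≤ p :=
  (Nat.prime_of_mem_primeFactors hp).two_le

lemma bound_T (n : ℕ) (hn : 0 < n) (hω : n.primeFactors.card ≤ 4) (T : Finset ℕ) (M : ℕ)
    (hM : 2 ≤ M) (hT : ∀ p ∈ T, 2 ≤ p ∧ p ≤ M) (hc : T.card = 4)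
    (hq : ∀ p, p.Prime → p ∣ n → p ∉ T → M ≤ p) (c : ℝ) (hprod : ∏ p ∈ T, g p ≤ c) :
    (ArithmeticFunction.sigma 1 n : ℝ) / n ≤ c :=
  (sigma_le_prod n hn).trans ((prod_le _ T M (fun _ hp => two_le_of_mem hp)
    (fun p hp => (hT p hp).1) hM
    (fun p hp hpT => hq p (Nat.prime_of_mem_primeFactors hp) (Nat.dvd_of_mem_primeFactors hp) hpT)
    (fun p hp => (hT p hp).2) (by omega)).trans hprod)

lemma bound_7 (n : ℕ) (hn : 0 < n) (hω : n.primeFactors.card ≤ 4) :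
    (ArithmeticFunction.sigma 1 n : ℝ) / n ≤ 4375 / 1000 := by
  refine bound_T n hn hω {2, 3, 5, 7} 7 (by norm_num) (by decide) (by decide) ?_ _
    (by norm_num [g])
  intro p hp hd hT
  by_contra hcon
  have : p < 7 := by omega
  interval_cases p <;> first | (norm_num at hp; done) | (simp at hT; done)

lemma bound_not (n : ℕ) (hn : 0 < n) (hω : n.primeFactors.card ≤ 4) (q : ℕ) (c : ℝ)
    (hq : q ∈ ({2, 3, 5, 7} : Finset ℕ)) (hqn : ¬ q ∣ n)
    (hprod : ∏ p ∈ ({2, 3, 5, 7, 11} : Finset ℕ).erase q, g p ≤ c) :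
    (ArithmeticFunction.sigma 1 n : ℝ) / n ≤ c := by
  refine bound_T n hn hω (({2, 3, 5, 7, 11} : Finset ℕ).erase q) 11 (by norm_num) ?_ ?_ ?_ _ hprod
  · intro p hp
    have := Finset.mem_of_mem_erase hp
    revert p; intro p _ hp
    simp only [Finset.mem_insert, Finset.mem_singleton] at hp
    omega
  · rw [Finset.card_erase_of_mem]
    · rfl
    · simp only [Finset.mem_insert, Finset.mem_singleton] at hq ⊢
      omega
  · intro p hp hd hT
    by_contra hcon
    have hlt : p < 11 := by omega
    have hpq : p ≠ q := by rintro rfl; exact hqn hd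
    have hT' : p ∉ ({2, 3, 5, 7, 11} : Finset ℕ) := fun h => hT (Finset.mem_erase.mpr ⟨hpq, h⟩)
    clear hpq hT
    interval_cases p <;> first | (norm_num at hp; done) | (simp at hT'; done)

lemma er2 : ({2, 3, 5, 7, 11} : Finset ℕ).erase 2 = {3, 5, 7, 11} := by decide
lemma er3 : ({2, 3, 5, 7, 11} : Finset ℕ).erase 3 = {2, 5, 7, 11} := by decide
lemma er5 : ({2, 3, 5, 7, 11} : Finset ℕ).erase 5 = {2, 3, 7, 11} := by decide
lemma er7 : ({2, 3, 5, 7, 11} : Finset ℕ).erase 7 = {2, 3, 5, 11} := by decide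

lemma P_all (n : ℕ) (hn : 3 ≤ n) (hω : n.primeFactors.card ≤ 4) : P n := by
  by_cases h7 : n < 7
  · left; interval_cases n <;> decide
  by_cases h0 : n < 1680
  · exact P1 n (by omega) h0
  have hpos : 0 < n := by omega
  have low0 : (ArithmeticFunction.sigma 1 n : ℝ) / n ≤ 33 / 10 → P n := fun h =>
    P_of_bound _ _ _ n b1' (by omega) (h.trans_lt (by norm_num))
  by_cases d2 : 2 ∣ n
  swap
  · exact low0 (bound_not n hpos hω 2 _ (by decide) d2 (by rw [er2]; norm_num [g]))
  by_cases d3 : 3 ∣ n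
  swap
  · exact low0 (bound_not n hpos hω 3 _ (by decide) d3 (by rw [er3]; norm_num [g]))
  by_cases h1 : n < 6200
  · exact P1' n (by omega) h1 (by omega)
  have low : (ArithmeticFunction.sigma 1 n : ℝ) / n ≤ 385 / 100 → P n := fun h =>
    P_of_bound _ _ _ n b1 (by omega) (h.trans_lt (by norm_num))
  by_cases d5 : 5 ∣ n
  swap
  · exact low (bound_not n hpos hω 5 _ (by decide) d5 (by rw [er5]; norm_num [g]))
  by_cases h2 : n < 27000
  · exact P2 n (by omega) h2 (by omega)
  by_cases d7 : 7 ∣ n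
  swap
  · have := bound_not n hpos hω 7 (4125 / 1000) (by decide) d7 (by rw [er7]; norm_num [g])
    exact P_of_bound _ _ _ n b2 (by omega) (this.trans_lt (by norm_num))
  by_cases h3 : n < 120000
  · exact P3 n (by omega) h3 (by omega)
  exact P_of_bound _ _ _ n b3 (by omega) ((bound_7 n hpos hω).trans_lt (by norm_num))

def excData : List (ℕ × ℕ × ℕ × ℕ) :=
  [(3, 2198, 189, 4), (4, 2773, 654, 7), (5, 3219, 952, 6), (6, 3584, 1167, 12),
   (8, 4159, 1465, 15), (9, 4395, 1575, 13), (10, 4606, 1669, 18), (12, 4970, 1821, 28),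
   (16, 5546, 2040, 31), (18, 5781, 2123, 39), (20, 5992, 2195, 42), (24, 6357, 2313, 60),
   (30, 6803, 2449, 72), (36, 7168, 2553, 91), (48, 7743, 2708, 124), (60, 8189, 2820, 168),
   (72, 8554, 2907, 195), (84, 8862, 2978, 224), (120, 9575, 3133, 360), (180, 10386, 3295, 546),
   (240, 10962, 3403, 744), (360, 11773, 3546, 1170), (720, 13159, 3768, 2418), (840, 13467, 3815, 2880),
   (2520, 15665, 4117, 9360), (5040, 17051, 4287, 19344)]

lemma ed1 : excData.all (fun x => ubOK x.1 x.2.1 x.2.2.1 &&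
    decide (∑ d ∈ Nat.divisors x.1, d = x.2.2.2) &&
    Nat.ble (17816 * x.2.2.1 * x.1) (x.2.2.2 * 20000000)) = true := by decide +kernel

lemma ed2 : exc.all (fun n => (excData.map (fun x => x.1)).elem n) = true := by decide +kernel

lemma exc_sound (n : ℕ) (h : n ∈ exc) :
    Real.exp Real.eulerMascheroniConstant * Real.log (Real.log n) ≤
        (ArithmeticFunction.sigma 1 n : ℝ) / n := by
  have h1 := List.all_eq_true.mp ed2 n h
  rw [List.elem_iff, List.mem_map] at h1
  obtain ⟨⟨m, a, b, s⟩, hx, rfl⟩ := h1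
  have h2 := List.all_eq_true.mp ed1 _ hx
  simp only [Bool.and_eq_true, Nat.ble_eq, decide_eq_true_eq] at h2 ⊢
  obtain ⟨⟨h3, h4⟩, h5⟩ := h2
  have h6 := ub_sound m a b h3
  have hm : 2 ≤ m := by
    simp only [ubOK, Bool.and_eq_true, Nat.ble_eq] at h3
    exact h3.2
  have hm' : (0 : ℝ) < m := by exact_mod_cast (by omega : 0 < m)
  rw [ArithmeticFunction.sigma_one_apply, h4, le_div_iff₀ hm']
  have h7 : (17816 : ℝ) * b * m ≤ s * 20000000 := by exact_mod_cast h5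
  have h8 : Real.exp Real.eulerMascheroniConstant * Real.log (Real.log m) ≤
      17816 / 10000 * (b / 2000) :=
    (mul_le_mul_of_nonneg_left h6 (Real.exp_pos _).le).trans
      (mul_le_mul_of_nonneg_right eg_lt.le (by positivity))
  have h9 := mul_le_mul_of_nonneg_right h8 hm'.le
  linarith

end RobinAux

theorem omega_le_four_robin_exceptions (n : ℕ) (hn : 3 ≤ n) (hω : n.primeFactors.card ≤ 4) :
    Real.exp Real.eulerMascheroniConstant * Real.log (Real.log n) ≤
        (ArithmeticFunction.sigma 1 n : ℝ) / n ↔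
      n ∈ ({3, 4, 5, 8, 9, 16, 6, 10, 12, 18, 20, 24, 36, 48, 72,
            30, 60, 84, 120, 180, 240, 360, 720, 840, 2520, 5040} : Set ℕ) := by
  have hset : n ∈ ({3, 4, 5, 8, 9, 16, 6, 10, 12, 18, 20, 24, 36, 48, 72,
            30, 60, 84, 120, 180, 240, 360, 720, 840, 2520, 5040} : Set ℕ) ↔ n ∈ RobinAux.exc := by
    simp [RobinAux.exc]
  rw [hset]
  constructor
  · intro h
    rcases RobinAux.P_all n hn hω with h1 | h1
    · exact h1
    · exact absurd h (not_le.mpr h1)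
  · exact RobinAux.exc_sound n
end
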